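/- arXiv:1709.01418 — 4 statements merged into one kernel-verified Lean document; each statement's English description precedes it below -/
import Mathlib

section
/- Let A be an injective self-adjoint bounded operator on a complex Hilbert space H, and suppose there exists a unitary U ∈ B(H) with UA = −AU. Then there exist a complex Hilbert space K, an injective positive operator C ∈ B(K), and a unitary (surjective linear isometry) V : H → K ⊕ K such that V A V⁻¹ = C ⊕ (−C). -/
noncomputable section

/-- The block operator `[[A, B], [C, D]]` on the Hilbert space direct sum `K ⊕₂ K`. -/
def blk {K : Type*} [NormedAddCommGroup K] [InnerProductSpace ℂ K]
    (A B C D : K →L[ℂ] K) : WithLp 2 (K × K) →L[ℂ] WithLp 2 (K × K) :=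
  ((WithLp.prodContinuousLinearEquiv 2 ℂ K K).symm : K × K →L[ℂ] WithLp 2 (K × K)) ∘L
    ((A.coprod B).prod (C.coprod D)) ∘L
    ((WithLp.prodContinuousLinearEquiv 2 ℂ K K) : WithLp 2 (K × K) →L[ℂ] K × K)

/-- If two elements satisfy `u * a = -(a * u)` then `u` commutes with `a * a`. -/
theorem commute_mul_self_of_mul_eq_neg {R : Type*} [Ring R] {u a : R} (h : u * a = -(a * u)) :
    Commute (a * a) u := by
  rw [Commute, SemiconjBy, mul_assoc, ← mul_assoc u, h, neg_mul, mul_assoc, h, mul_neg, neg_neg]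

/-- A self-adjoint operator `A` has a symmetric `R` that is positive, squares to `A * A` and
commutes with everything that commutes with `A * A`. -/
theorem exists_sqrt_mul_self {H : Type*}
    [NormedAddCommGroup H] [InnerProductSpace ℂ H] [CompleteSpace H]
    (A : H →L[ℂ] H) (hA : IsSelfAdjoint A) :
    ∃ R : H →L[ℂ] H, R.IsPositive ∧ R * R = A * A ∧
      ∀ T : H →L[ℂ] H, Commute (A * A) T → Commute R T := by
  have h0 : 0 ≤ A * A := by simpa [hA.star_eq] using star_mul_self_nonneg A
  refine ⟨CFC.sqrt (A * A), ?_, CFC.sqrt_mul_sqrt_self _ h0, fun T hT => ?_⟩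
  · exact (ContinuousLinearMap.nonneg_iff_isPositive _).1 (CFC.sqrt_nonneg _)
  · exact hT.cfcₙ_nnreal _

/-- If `A` is an injective self-adjoint bounded operator anticommuting with some unitary,
then `A` is unitarily equivalent to `C ⊕ (−C)` for an injective positive operator `C`. -/
theorem injective_selfAdjoint_anticommutes_unitary_iff_offdiag {H : Type u}
    [NormedAddCommGroup H] [InnerProductSpace ℂ H] [CompleteSpace H]
    (A : H →L[ℂ] H) (hA : IsSelfAdjoint A) (hinj : Function.Injective A)
    (hU : ∃ U ∈ unitary (H →L[ℂ] H), U * A = -(A * U)) :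
    ∃ (K : Type u) (_ : NormedAddCommGroup K) (_ : InnerProductSpace ℂ K)
      (_ : CompleteSpace K) (C : K →L[ℂ] K) (V : H ≃ₗᵢ[ℂ] WithLp 2 (K × K)),
      C.IsPositive ∧ Function.Injective C ∧
      ∀ x : H, V (A x) = blk C 0 0 (-C) (V x) := by
  obtain ⟨U, hUu, hUA⟩ := hU
  obtain ⟨R, hRpos, hRR, hRcomm⟩ := exists_sqrt_mul_self A hA
  have hRA : ∀ x, R (A x) = A (R x) := fun x =>
    DFunLike.congr_fun (hRcomm A (Commute.mul_left rfl rfl)).eq x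
  have hRU : ∀ x, R (U x) = U (R x) := fun x =>
    DFunLike.congr_fun (hRcomm U (commute_mul_self_of_mul_eq_neg hUA)).eq x
  have hRR' : ∀ x, R (R x) = A (A x) := fun x => DFunLike.congr_fun hRR x
  have hAU : ∀ x, A (U x) = -U (A x) := fun x => by
    have h : U (A x) = -A (U x) := DFunLike.congr_fun hUA x
    rw [h, neg_neg]
  have hUU : ∀ x, U (star U x) = x := fun x =>
    DFunLike.congr_fun (Unitary.mul_star_self_of_mem hUu) x
  have hUnorm : ∀ x, ‖U x‖ = ‖x‖ := fun x => ContinuousLinearMap.norm_map_of_mem_unitary hUu x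
  have hUinj : Function.Injective U := fun x y h => by
    have := hUnorm (x - y)
    rwa [map_sub, h, sub_self, norm_zero, eq_comm, norm_eq_zero, sub_eq_zero] at this
  have hAsymm : ∀ x y, inner ℂ (A x) y = inner ℂ x (A y) := hA.isSymmetric
  have hRsymm : ∀ x y, inner ℂ (R x) y = inner ℂ x (R y) := hRpos.isSelfAdjoint.isSymmetric
  let K : Submodule ℂ H := (R - A).ker
  have hK : ∀ x, x ∈ K ↔ R x = A x := fun x => by
    simp [K, sub_eq_zero]
  have : CompleteSpace K := (R - A).isClosed_ker.completeSpace_coe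
  have hKperp : ∀ z ∈ Kᗮ, R z = -A z := fun z hz => by
    rw [eq_neg_iff_add_eq_zero]
    refine ext_inner_left ℂ fun w => ?_
    have hw : R w + A w ∈ K := by
      rw [hK, map_add, map_add, hRA, hRR', add_comm]
    rw [inner_zero_right, inner_add_right, ← hRsymm, ← hAsymm, ← inner_add_left]
    exact hz _ hw
  have hperp : ∀ y, R y = -A y → y ∈ Kᗮ := fun y hy => by
    obtain ⟨p, hp, q, hq, rfl⟩ := K.exists_add_mem_mem_orthogonal y
    have h1 := (hK p).1 hp
    have h2 := hKperp q hq
    have : Module ℚ H := Module.compHom H (algebraMap ℚ ℂ)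
    have : IsAddTorsionFree H := .of_module_rat H
    rw [map_add, map_add, h1, h2, neg_add, add_left_inj, self_eq_neg] at hy
    rw [hinj (hy.trans (map_zero A).symm), zero_add]
    exact hq
  have hUK : ∀ b ∈ K, U b ∈ Kᗮ := fun b hb => hperp _ <| by
    rw [hRU, hAU, (hK b).1 hb, neg_neg]
  have hAK : ∀ b ∈ K, A b ∈ K := fun b hb => by
    rw [hK, hRA, (hK b).1 hb]
  let C : K →L[ℂ] K := (A ∘L K.subtypeL).codRestrict K fun b => hAK b b.2
  have hC : ∀ b : K, (C b : H) = A b := fun _ => rfl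
  let W₀ : WithLp 2 (K × K) →ₗ[ℂ] H :=
    (K.subtype.coprod (U.toLinearMap ∘ₗ K.subtype)) ∘ₗ
      (WithLp.linearEquiv 2 ℂ (K × K)).toLinearMap
  have hW₀ : ∀ z, W₀ z = (z.fst : H) + U z.snd := fun _ => rfl
  let W : WithLp 2 (K × K) →ₗᵢ[ℂ] H := ⟨W₀, fun z => by
    have h : inner ℂ (z.fst : H) (U z.snd) = 0 := hUK _ z.snd.2 _ z.fst.2
    rw [← sq_eq_sq₀ (norm_nonneg _) (norm_nonneg _), WithLp.prod_norm_sq_eq_of_L2, hW₀, sq,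
      norm_add_sq_eq_norm_sq_add_norm_sq_of_inner_eq_zero _ _ h, hUnorm]
    simp only [sq, Submodule.coe_norm]⟩
  have hW : ∀ z, W z = (z.fst : H) + U z.snd := hW₀
  have hWsurj : Function.Surjective W := fun x => by
    obtain ⟨p, hp, q, hq, rfl⟩ := K.exists_add_mem_mem_orthogonal x
    have hb : star U q ∈ K := by
      rw [hK]
      apply hUinj
      rw [← hRU, ← neg_eq_iff_eq_neg.2 (hAU _), hUU, hKperp q hq]
    refine ⟨WithLp.toLp 2 (⟨p, hp⟩, ⟨star U q, hb⟩), ?_⟩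
    rw [hW]
    exact congrArg (p + ·) (hUU q)
  let V := (LinearIsometryEquiv.ofSurjective W hWsurj).symm
  refine ⟨K, inferInstance, inferInstance, this, C, V, ?_, ?_, fun x => ?_⟩
  · refine ContinuousLinearMap.isPositive_def.2 ⟨fun x y => hAsymm x y, fun x => ?_⟩
    have h := hRpos.re_inner_nonneg_left (x : H)
    rw [(hK x).1 x.2] at h
    exact h
  · exact fun x y h => Subtype.ext (hinj (congrArg Subtype.val h))
  · obtain ⟨z, rfl⟩ := hWsurj x
    have hV : ∀ z, V (W z) = z :=
      fun z => (LinearIsometryEquiv.ofSurjective W hWsurj).symm_apply_apply z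
    have h : A (W z) = W (blk C 0 0 (-C) z) := by
      have h1 : (blk C 0 0 (-C) z).fst = C z.fst := by simp [blk]
      have h2 : (blk C 0 0 (-C) z).snd = -C z.snd := by simp [blk]
      rw [hW, hW, h1, h2, map_add, hAU, Submodule.coe_neg, map_neg, hC, hC]
    rw [h, hV, hV]
end
end

section
/- Let λ ∈ ℝ \ {−1, 0, 1}, let K be a complex Hilbert space, let B be a positive operator on K with (|1−|λ||/2)·I < B < ((1+|λ|)/2)·I (hence B is invertible), and let T = (B ⊕ (−B)) + ((1+λ)/2)·I on H = K ⊕ K. Set c = (1+λ)/2 and d = (1−λ)/2, and put P₁₁ = B⁻¹(B + cI)(B − dI), P₂₂ = −B⁻¹(B − cI)(B + dI), Q₁₁ = B⁻¹(B + cI)(B + dI), Q₂₂ = −B⁻¹(B − cI)(B − dI), and P₁₂ = B⁻¹·(−(B² − c²I)(B² − d²I))^{1/2} (positive square root). For each unitary U ∈ B(K) commuting with B define P_U = (1/(2λ))·[[P₁₁, P₁₂U],[U*P₁₂, P₂₂]] and Q_U = (1/2)·[[Q₁₁, −P₁₂U],[−U*P₁₂, Q₂₂]] as 2×2 block operators on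 K ⊕ K. Then every (P_U, Q_U) is a pair of orthogonal projections with λP_U + Q_U = T, and conversely every pair (P, Q) of orthogonal projections on H with T = λP + Q equals (P_U, Q_U) for some unitary U ∈ B(K) commuting with B. -/
set_option synthInstance.maxHeartbeats 400000
set_option maxHeartbeats 800000

noncomputable section

/-- `P` is an orthogonal projection: self-adjoint and idempotent. -/
def IsOrthoProj {H : Type*} [NormedAddCommGroup H] [InnerProductSpace ℂ H] [CompleteSpace H]
    (P : H →L[ℂ] H) : Prop :=
  IsSelfAdjoint P ∧ P * P = P

/-- Strict operator inequality `A < B`: `B − A` is positive and injective. -/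
def OpLt {H : Type*} [NormedAddCommGroup H] [InnerProductSpace ℂ H] [CompleteSpace H]
    (A B : H →L[ℂ] H) : Prop :=
  (B - A).IsPositive ∧ Function.Injective (B - A)

variable {K : Type*} [NormedAddCommGroup K] [InnerProductSpace ℂ K] [CompleteSpace K]

/-- `c = (1+λ)/2` as a scalar operator coefficient. -/
def cc (lam : ℝ) : ℂ := (((1 + lam) / 2 : ℝ) : ℂ)

/-- `d = (1−λ)/2` as a scalar operator coefficient. -/
def dd (lam : ℝ) : ℂ := (((1 - lam) / 2 : ℝ) : ℂ)

/-- `P₁₁ = B⁻¹(B + cI)(B − dI)`. -/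
def P11 (lam : ℝ) (B : K →L[ℂ] K) : K →L[ℂ] K :=
  Ring.inverse B * (B + cc lam • 1) * (B - dd lam • 1)

/-- `P₂₂ = −B⁻¹(B − cI)(B + dI)`. -/
def P22 (lam : ℝ) (B : K →L[ℂ] K) : K →L[ℂ] K :=
  -(Ring.inverse B * (B - cc lam • 1) * (B + dd lam • 1))

/-- `Q₁₁ = B⁻¹(B + cI)(B + dI)`. -/
def Q11 (lam : ℝ) (B : K →L[ℂ] K) : K →L[ℂ] K :=
  Ring.inverse B * (B + cc lam • 1) * (B + dd lam • 1)

/-- `Q₂₂ = −B⁻¹(B − cI)(B − dI)`. -/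
def Q22 (lam : ℝ) (B : K →L[ℂ] K) : K →L[ℂ] K :=
  -(Ring.inverse B * (B - cc lam • 1) * (B - dd lam • 1))

/-- `P₁₂ = B⁻¹ (−(B² − c²I)(B² − d²I))^{1/2}` (positive square root). -/
def P12 (lam : ℝ) (B : K →L[ℂ] K) : K →L[ℂ] K :=
  Ring.inverse B *
    CFC.sqrt (-((B ^ 2 - cc lam ^ 2 • 1) * (B ^ 2 - dd lam ^ 2 • 1)))

/-- The projection `P_U = (1/(2λ))·[[P₁₁, P₁₂U], [U*P₁₂, P₂₂]]`. -/
def PU (lam : ℝ) (B U : K →L[ℂ] K) : WithLp 2 (K × K) →L[ℂ] WithLp 2 (K × K) :=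
  (((2 * lam)⁻¹ : ℝ) : ℂ) •
    blk (P11 lam B) (P12 lam B * U) (star U * P12 lam B) (P22 lam B)

/-- The projection `Q_U = (1/2)·[[Q₁₁, −P₁₂U], [−U*P₁₂, Q₂₂]]`. -/
def QU (lam : ℝ) (B U : K →L[ℂ] K) : WithLp 2 (K × K) →L[ℂ] WithLp 2 (K × K) :=
  (((2 : ℝ)⁻¹ : ℝ) : ℂ) •
    blk (Q11 lam B) (-(P12 lam B * U)) (-(star U * P12 lam B)) (Q22 lam B)

section Block

variable {K : Type*} [NormedAddCommGroup K] [InnerProductSpace ℂ K]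

lemma blk_apply (A B C D : K →L[ℂ] K) (x : WithLp 2 (K × K)) :
    blk A B C D x = WithLp.toLp 2 (A x.fst + B x.snd, C x.fst + D x.snd) := rfl

@[simp] lemma blk_apply_fst (A B C D : K →L[ℂ] K) (x : WithLp 2 (K × K)) :
    (blk A B C D x).fst = A x.fst + B x.snd := rfl

@[simp] lemma blk_apply_snd (A B C D : K →L[ℂ] K) (x : WithLp 2 (K × K)) :
    (blk A B C D x).snd = C x.fst + D x.snd := rfl

lemma ext_fst_snd {X Y : WithLp 2 (K × K) →L[ℂ] WithLp 2 (K × K)}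
    (h₁ : ∀ x, (X x).fst = (Y x).fst) (h₂ : ∀ x, (X x).snd = (Y x).snd) : X = Y :=
  ContinuousLinearMap.ext fun x => WithLp.ofLp_injective 2 (Prod.ext (h₁ x) (h₂ x))

lemma blk_mul (A B C D A' B' C' D' : K →L[ℂ] K) :
    blk A B C D * blk A' B' C' D' =
      blk (A * A' + B * C') (A * B' + B * D') (C * A' + D * C') (C * B' + D * D') := by
  apply ext_fst_snd <;> intro x <;> simp <;> abel

lemma blk_add (A B C D A' B' C' D' : K →L[ℂ] K) :
    blk A B C D + blk A' B' C' D' = blk (A + A') (B + B') (C + C') (D + D') := by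
  apply ext_fst_snd <;> intro x <;> simp <;> abel

lemma blk_smul (r : ℂ) (A B C D : K →L[ℂ] K) :
    r • blk A B C D = blk (r • A) (r • B) (r • C) (r • D) := by
  apply ext_fst_snd <;> intro x <;> simp

lemma blk_one : blk (1 : K →L[ℂ] K) 0 0 1 = 1 := by
  apply ext_fst_snd <;> intro x <;> simp

lemma blk_injective {A B C D A' B' C' D' : K →L[ℂ] K} (h : blk A B C D = blk A' B' C' D') :
    A = A' ∧ B = B' ∧ C = C' ∧ D = D' := by
  have h₁ (x : K) := congrArg (fun f => f (WithLp.toLp 2 (x, 0))) h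
  have h₂ (x : K) := congrArg (fun f => f (WithLp.toLp 2 (0, x))) h
  simp only [blk_apply, WithLp.toLp_fst, WithLp.toLp_snd, map_zero, add_zero, zero_add,
    WithLp.toLp.injEq, Prod.mk.injEq] at h₁ h₂
  exact ⟨ContinuousLinearMap.ext fun x => (h₁ x).1, ContinuousLinearMap.ext fun x => (h₂ x).1,
    ContinuousLinearMap.ext fun x => (h₁ x).2, ContinuousLinearMap.ext fun x => (h₂ x).2⟩

lemma exists_eq_blk (X : WithLp 2 (K × K) →L[ℂ] WithLp 2 (K × K)) :
    ∃ A B C D : K →L[ℂ] K, X = blk A B C D := by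
  let e := WithLp.prodContinuousLinearEquiv 2 ℂ K K
  let Y : K × K →L[ℂ] K × K := (e : _ →L[ℂ] K × K) ∘L X ∘L (e.symm : K × K →L[ℂ] _)
  let i := ContinuousLinearMap.inl ℂ K K
  let j := ContinuousLinearMap.inr ℂ K K
  let p := ContinuousLinearMap.fst ℂ K K
  let q := ContinuousLinearMap.snd ℂ K K
  refine ⟨p ∘L Y ∘L i, p ∘L Y ∘L j, q ∘L Y ∘L i, q ∘L Y ∘L j, ?_⟩
  ext1 x
  have hx : x = e.symm (x.fst, 0) + e.symm (0, x.snd) := by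
    rw [← map_add, Prod.mk_add_mk, add_zero, zero_add]
    rfl
  conv_lhs => rw [hx, map_add]
  rfl

lemma star_blk [CompleteSpace K] (A B C D : K →L[ℂ] K) :
    star (blk A B C D) = blk (star A) (star C) (star B) (star D) := by
  symm
  rw [ContinuousLinearMap.star_eq_adjoint (blk A B C D), ContinuousLinearMap.eq_adjoint_iff]
  intro x y
  simp only [blk_apply, WithLp.prod_inner_apply, inner_add_left, inner_add_right,
    ContinuousLinearMap.star_eq_adjoint, ContinuousLinearMap.adjoint_inner_left,
    WithLp.fst, WithLp.snd]
  ring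

end Block

section Operators

variable {K : Type*} [NormedAddCommGroup K] [InnerProductSpace ℂ K]

lemma mul_left_cancel_of_injective {N X Y : K →L[ℂ] K} (hN : Function.Injective N)
    (h : N * X = N * Y) : X = Y :=
  ContinuousLinearMap.ext fun x => hN (DFunLike.congr_fun h x)

variable [CompleteSpace K]

lemma mul_right_cancel_of_injective_star {N X Y : K →L[ℂ] K}
    (hN : Function.Injective (star N : K →L[ℂ] K)) (h : X * N = Y * N) : X = Y := by
  apply star_injective
  apply mul_left_cancel_of_injective hN
  simpa using congrArg star h

/-- Polar decomposition of an operator `V` with `V V* = V* V = N²`, where `N` is self-adjoint and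
injective. -/
lemma exists_unitary_eq_mul {N V : K →L[ℂ] K} (hN : IsSelfAdjoint N)
    (hinj : Function.Injective N) (h₁ : V * star V = N * N) (h₂ : star V * V = N * N) :
    ∃ U ∈ unitary (K →L[ℂ] K), V = N * U := by
  have hVinj : Function.Injective V := by
    have : Function.Injective (star V * V) := h₂ ▸ hinj.comp hinj
    exact Function.Injective.of_comp (f := (star V : K →L[ℂ] K)) this
  have hdense : DenseRange (N : K →ₗ[ℂ] K) := by
    have h : N.rangeᗮ = ⊥ := by
      rw [ContinuousLinearMap.IsStarNormal.orthogonal_range hN.isStarNormal]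
      exact LinearMap.ker_eq_bot.2 hinj
    rw [← Submodule.topologicalClosure_eq_top_iff] at h
    exact (Submodule.dense_iff_topologicalClosure_eq_top).2 h
  have hnorm (x : K) : ‖(star V) x‖ = ‖N x‖ := by
    have e : inner ℂ (star V x) (star V x) = inner ℂ (N x) (N x) := by
      have h := DFunLike.congr_fun h₁ x
      simp only [mul_apply_eq_comp] at h
      conv_lhs => rw [ContinuousLinearMap.star_eq_adjoint, ContinuousLinearMap.adjoint_inner_left,
        ← ContinuousLinearMap.star_eq_adjoint, h]
      conv_rhs => rw [← hN.adjoint_eq, ContinuousLinearMap.adjoint_inner_left, hN.adjoint_eq]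
    rw [inner_self_eq_norm_sq_to_K, inner_self_eq_norm_sq_to_K] at e
    have e' : ‖(star V) x‖ ^ 2 = ‖N x‖ ^ 2 := by exact_mod_cast e
    exact (sq_eq_sq₀ (norm_nonneg _) (norm_nonneg _)).1 e'
  let W : K →L[ℂ] K :=
    LinearMap.extendOfNorm ((star V : K →L[ℂ] K) : K →ₗ[ℂ] K) (N : K →ₗ[ℂ] K)
  have hW : W * N = star V := ContinuousLinearMap.ext fun x =>
    LinearMap.extendOfNorm_eq (f := ((star V : K →L[ℂ] K) : K →ₗ[ℂ] K)) hdense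
      ⟨1, fun y => by simpa using (hnorm y).le⟩ x
  have hV : V = N * star W := by
    have := congrArg star hW
    simpa [hN.star_eq] using this.symm
  have hNs : Function.Injective (star N : K →L[ℂ] K) := by rwa [hN.star_eq]
  have hWW : star W * W = 1 := by
    apply mul_left_cancel_of_injective hinj
    apply mul_right_cancel_of_injective_star hNs
    rw [mul_one, ← h₁, ← hW, ← mul_assoc, ← hV, mul_assoc]
  have hWW' : W * star W = 1 := by
    apply mul_right_cancel_of_injective_star (N := star V) (by rwa [star_star])
    rw [← hW, mul_assoc, ← mul_assoc (star W), hWW, one_mul, one_mul]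
  exact ⟨star W, Unitary.mem_iff.2 ⟨by rwa [star_star], by rwa [star_star]⟩, hV⟩

lemma eq_zero_of_anticommute {B Y : K →L[ℂ] K} (hB : 0 ≤ B) (hu : IsUnit B)
    (h : B * Y + Y * B = 0) : Y = 0 := by
  have h' : B * Y = -(Y * B) := eq_neg_of_add_eq_zero_left h
  have h2 : Commute (B * B) Y := by
    rw [commute_iff_eq, mul_assoc, h', mul_neg, ← mul_assoc, h', neg_mul, neg_neg, mul_assoc]
  have h3 : Commute B Y := by
    have := h2.cfcₙ_nnreal NNReal.sqrt
    rwa [show cfcₙ NNReal.sqrt (B * B) = B from CFC.sqrt_mul_self B hB] at this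
  rw [← h3.eq, ← two_smul ℂ, smul_eq_zero] at h
  exact (hu.mul_right_eq_zero).1 (h.resolve_left two_ne_zero)

lemma isUnit_of_smul_one_le {B : K →L[ℂ] K} {m : ℝ} (hm : 0 < m)
    (h : (B - (m : ℂ) • (1 : K →L[ℂ] K)).IsPositive) : IsUnit B := by
  refine ContinuousLinearMap.isUnit_of_forall_le_norm_inner_map B (c := ⟨m, hm.le⟩) hm fun x => ?_
  have := h.re_inner_nonneg_left x
  refine le_trans ?_ (RCLike.re_le_norm _)
  rw [sub_apply, inner_sub_left, map_sub, smul_apply, one_apply_eq_self, inner_smul_left,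
    inner_self_eq_norm_sq_to_K, Complex.conj_ofReal] at this
  have e : RCLike.re ((m : ℂ) * ((‖x‖ : ℝ) : ℂ) ^ 2) = m * ‖x‖ ^ 2 := by
    rw [← Complex.ofReal_pow, ← Complex.ofReal_mul]
    rfl
  have this' : 0 ≤ RCLike.re (inner ℂ (B x) x) - m * ‖x‖ ^ 2 := e ▸ this
  change ‖x‖ ^ 2 * m ≤ _
  linarith

/-- A block operator `(2μ)⁻¹ [[μ + X, NU], [U*N, μ - X]]` with `X² + N² = μ²` is an orthogonal
projection. -/
lemma isOrthoProj_blk {X N U : K →L[ℂ] K} {μ : ℝ} (hμ : μ ≠ 0) (hX : IsSelfAdjoint X)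
    (hN : IsSelfAdjoint N) (hXN : Commute X N) (hXU : Commute X U) (hNU : Commute N U)
    (hU : U ∈ unitary (K →L[ℂ] K)) (h : X * X + N * N = ((μ : ℂ) ^ 2) • 1) :
    IsOrthoProj ((((2 * μ)⁻¹ : ℝ) : ℂ) •
      blk ((μ : ℂ) • 1 + X) (N * U) (star U * N) ((μ : ℂ) • 1 - X)) := by
  have hμ' : (μ : ℂ) ≠ 0 := by exact_mod_cast hμ
  have hXU' : X * star U = star U * X := by
    have := congrArg star hXU.eq
    simpa [hX.star_eq] using this.symm
  have hN2 : N * N = ((μ : ℂ) ^ 2) • 1 - X * X := eq_sub_of_add_eq' h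
  refine ⟨?_, ?_⟩
  · rw [IsSelfAdjoint, star_smul, star_blk]
    simp [hX.star_eq, hN.star_eq]
  · have e₁ : N * U * (star U * N) = N * N := by
      rw [mul_assoc, ← mul_assoc U, Unitary.mul_star_self_of_mem hU, one_mul]
    have e₂ : star U * N * (N * U) = N * N := by
      rw [mul_assoc, ← mul_assoc N, (hNU.mul_left hNU).eq, ← mul_assoc,
        Unitary.star_mul_self_of_mem hU, one_mul]
    have e₃ : N * U * X = X * (N * U) := ((hXN.mul_right hXU).eq).symm
    have e₄ : X * (star U * N) = star U * N * X := by
      rw [← mul_assoc, hXU', mul_assoc, hXN.eq, mul_assoc]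
    rw [smul_mul_smul_comm, blk_mul, blk_smul, blk_smul]
    push_cast
    congr 1
    all_goals
      simp only [mul_add, add_mul, mul_sub, sub_mul, smul_mul_assoc, mul_smul_comm, one_mul,
        mul_one, e₁, e₂, e₃, e₄, hN2]
      match_scalars <;> field_simp <;> ring

/-- A positive invertible `B` determines the block projections `P` for which
`D P + P D` is prescribed, `D = B ⊕ (-B)`, up to a unitary commuting with `B`. -/
lemma exists_unitary_of_anticommutator {B X N : K →L[ℂ] K} {μ : ℝ} (hμ : μ ≠ 0) (hB : 0 ≤ B)
    (hu : IsUnit B) (hBX : Commute B X) (hBN : Commute B N)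
    (hN : IsSelfAdjoint N) (hinj : Function.Injective N)
    (h : X * X + N * N = ((μ : ℂ) ^ 2) • 1)
    {P : WithLp 2 (K × K) →L[ℂ] WithLp 2 (K × K)} (hP : IsOrthoProj P)
    (hPB : (μ : ℂ) • (blk B 0 0 (-B) * P + P * blk B 0 0 (-B)) =
      blk (B * ((μ : ℂ) • 1 + X)) 0 0 (-(B * ((μ : ℂ) • 1 - X)))) :
    ∃ U ∈ unitary (K →L[ℂ] K), Commute U B ∧ P = (((2 * μ)⁻¹ : ℝ) : ℂ) •
      blk ((μ : ℂ) • 1 + X) (N * U) (star U * N) ((μ : ℂ) • 1 - X) := by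
  have hμ' : (μ : ℂ) ≠ 0 := by exact_mod_cast hμ
  obtain ⟨a, b, b', e, rfl⟩ := exists_eq_blk P
  obtain ⟨hs, hid⟩ := hP
  rw [IsSelfAdjoint, star_blk] at hs
  obtain ⟨-, -, rfl, -⟩ := blk_injective hs
  rw [blk_mul] at hid
  obtain ⟨i₁, -, -, i₄⟩ := blk_injective hid
  simp only [blk_mul, blk_add, blk_smul] at hPB
  obtain ⟨p₁, p₂, -, p₄⟩ := blk_injective hPB
  simp only [zero_mul, mul_zero, add_zero, zero_add, mul_neg, neg_mul] at p₁ p₂ p₄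
  have hN2 : N * N = ((μ : ℂ) ^ 2) • 1 - X * X := eq_sub_of_add_eq' h
  have ha : a = (2 * (μ : ℂ))⁻¹ • ((μ : ℂ) • 1 + X) := by
    rw [← sub_eq_zero]
    apply eq_zero_of_anticommute hB hu
    have : B * a + a * B = (μ : ℂ)⁻¹ • (B * ((μ : ℂ) • 1 + X)) := by
      rw [← p₁, smul_smul, inv_mul_cancel₀ hμ', one_smul]
    rw [mul_sub, sub_mul, sub_add_sub_comm, this]
    simp only [mul_add, add_mul, smul_mul_assoc, mul_smul_comm, one_mul, mul_one, ← hBX.eq]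
    match_scalars <;> field_simp <;> ring
  have he : e = (2 * (μ : ℂ))⁻¹ • ((μ : ℂ) • 1 - X) := by
    rw [← sub_eq_zero]
    apply eq_zero_of_anticommute hB hu
    have : B * e + e * B = (μ : ℂ)⁻¹ • (B * ((μ : ℂ) • 1 - X)) := by
      rw [← neg_inj, ← smul_neg, ← p₄, smul_smul, inv_mul_cancel₀ hμ', one_smul, neg_add]
    rw [mul_sub, sub_mul, sub_add_sub_comm, this]
    simp only [mul_sub, sub_mul, smul_mul_assoc, mul_smul_comm, one_mul, mul_one, ← hBX.eq]
    match_scalars <;> field_simp <;> ring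
  have hBb : B * b = b * B := by
    rw [smul_eq_zero_iff_right hμ', add_neg_eq_zero] at p₂
    exact p₂
  have hstar : star ((2 * (μ : ℂ)) • b) = (2 * (μ : ℂ)) • star b := by simp
  obtain ⟨U, hU, hV⟩ := exists_unitary_eq_mul (V := (2 * (μ : ℂ)) • b) hN hinj
    (by
      rw [hstar, smul_mul_smul_comm, eq_sub_of_add_eq' i₁, ha, hN2]
      simp only [mul_add, add_mul, smul_mul_assoc, mul_smul_comm, one_mul, mul_one]
      match_scalars <;> field_simp <;> ring)
    (by
      rw [hstar, smul_mul_smul_comm, eq_sub_of_add_eq i₄, he, hN2]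
      simp only [mul_sub, sub_mul, smul_mul_assoc, mul_smul_comm, one_mul, mul_one]
      match_scalars <;> field_simp <;> ring)
  have hb : b = (2 * (μ : ℂ))⁻¹ • (N * U) := by
    rw [← hV, smul_smul, inv_mul_cancel₀ (mul_ne_zero two_ne_zero hμ'), one_smul]
  refine ⟨U, hU, ?_, ?_⟩
  · apply mul_left_cancel_of_injective hinj
    rw [← mul_assoc, ← hV, ← mul_assoc, ← hBN.eq, mul_assoc, ← hV, smul_mul_assoc, mul_smul_comm,
      hBb]
  · rw [blk_smul]
    push_cast
    rw [← ha, ← hb, ← he, hb]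
    congr 1
    simp [hN.star_eq]

end Operators

section Entries

variable {K : Type*} [NormedAddCommGroup K] [InnerProductSpace ℂ K]

lemma cc_add_dd (lam : ℝ) : cc lam + dd lam = 1 := by
  rw [cc, dd]; push_cast; ring

lemma cc_sub_dd (lam : ℝ) : cc lam - dd lam = lam := by
  rw [cc, dd]; push_cast; ring

lemma cc_eq (lam : ℝ) : cc lam = (1 + lam) / 2 := by
  rw [cc]; push_cast; ring

lemma dd_eq (lam : ℝ) : dd lam = (1 - lam) / 2 := by
  rw [dd]; push_cast; ring

variable {lam : ℝ} {B : K →L[ℂ] K}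

lemma P11_eq (hu : IsUnit B) :
    P11 lam B = (lam : ℂ) • 1 + (B - (cc lam * dd lam) • Ring.inverse B) := by
  have h := Ring.inverse_mul_cancel B hu
  rw [P11]
  simp only [mul_add, add_mul, mul_sub, smul_mul_assoc, mul_smul_comm, one_mul, mul_one,
    h, cc_eq, dd_eq]
  match_scalars <;> ring

lemma P22_eq (hu : IsUnit B) :
    P22 lam B = (lam : ℂ) • 1 - (B - (cc lam * dd lam) • Ring.inverse B) := by
  have h := Ring.inverse_mul_cancel B hu
  rw [P22]
  simp only [mul_add, mul_sub, sub_mul, smul_mul_assoc, mul_smul_comm, one_mul, mul_one,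
    h, cc_eq, dd_eq]
  match_scalars <;> ring

lemma Q11_eq (hu : IsUnit B) :
    Q11 lam B = 1 + (B + (cc lam * dd lam) • Ring.inverse B) := by
  have h := Ring.inverse_mul_cancel B hu
  rw [Q11]
  simp only [mul_add, add_mul, smul_mul_assoc, mul_smul_comm, one_mul, mul_one,
    h, cc_eq, dd_eq]
  match_scalars <;> ring

lemma Q22_eq (hu : IsUnit B) :
    Q22 lam B = 1 - (B + (cc lam * dd lam) • Ring.inverse B) := by
  have h := Ring.inverse_mul_cancel B hu
  rw [Q22]
  simp only [mul_sub, sub_mul, smul_mul_assoc, mul_smul_comm, one_mul, mul_one,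
    h, cc_eq, dd_eq]
  match_scalars <;> ring

lemma P12_radicand_eq : -((B ^ 2 - cc lam ^ 2 • 1) * (B ^ 2 - dd lam ^ 2 • 1)) =
    ((B - ((abs (1 - |lam|) / 2 : ℝ) : ℂ) • 1) * ((((1 + |lam|) / 2 : ℝ) : ℂ) • 1 - B)) *
      ((B + ((abs (1 - |lam|) / 2 : ℝ) : ℂ) • 1) * (B + (((1 + |lam|) / 2 : ℝ) : ℂ) • 1)) := by
  set m : ℂ := ((abs (1 - |lam|) / 2 : ℝ) : ℂ) with hm
  set M : ℂ := (((1 + |lam|) / 2 : ℝ) : ℂ) with hM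
  have hm2 : m ^ 2 = ((1 - |lam|) / 2 : ℝ) ^ 2 := by
    rw [hm, ← Complex.ofReal_pow, ← Complex.ofReal_pow, div_pow, sq_abs, div_pow]
  have h : (m ^ 2 = cc lam ^ 2 ∧ M ^ 2 = dd lam ^ 2) ∨
      (m ^ 2 = dd lam ^ 2 ∧ M ^ 2 = cc lam ^ 2) := by
    rcases abs_cases lam with ⟨h, -⟩ | ⟨h, -⟩
    · right; rw [hm2, hM, h, cc, dd]; exact ⟨rfl, rfl⟩
    · left; rw [hm2, hM, h, cc, dd, sub_neg_eq_add, ← sub_eq_add_neg]; exact ⟨rfl, rfl⟩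
  have e : ((B - m • 1) * (M • 1 - B)) * ((B + m • 1) * (B + M • 1)) =
      -((B ^ 2 - m ^ 2 • 1) * (B ^ 2 - M ^ 2 • 1)) := by
    simp only [pow_two, mul_add, add_mul, mul_sub, sub_mul, smul_mul_assoc, mul_smul_comm, one_mul,
      mul_one, mul_assoc]
    match_scalars <;> ring
  rw [e]
  rcases h with ⟨h₁, h₂⟩ | ⟨h₁, h₂⟩
  · rw [h₁, h₂]
  · rw [h₁, h₂]
    simp only [pow_two, mul_sub, sub_mul, smul_mul_assoc, mul_smul_comm, one_mul, mul_one]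
    match_scalars <;> ring

lemma commute_ringInverse {U : K →L[ℂ] K} (h : Commute B U) (hu : IsUnit B) :
    Commute (Ring.inverse B) U := by
  obtain ⟨u, rfl⟩ := hu
  rw [Ring.inverse_unit]
  exact h.units_inv_left

lemma commute_sub_smul_ringInverse {U : K →L[ℂ] K} (h : Commute B U) (hu : IsUnit B) (z : ℂ) :
    Commute (B - z • Ring.inverse B) U :=
  h.sub_left ((commute_ringInverse h hu).smul_left z)

variable [CompleteSpace K]

/-- The strict bounds on `B` make `B` invertible, and the operator under the square root in `P12`
positive and injective. -/
lemma isUnit_and_radicand_nonneg_injective (hlam : lam ≠ -1 ∧ lam ≠ 1) (hBpos : B.IsPositive)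
    (hB₁ : OpLt (((abs (1 - |lam|) / 2 : ℝ) : ℂ) • (1 : K →L[ℂ] K)) B)
    (hB₂ : OpLt B ((((1 + |lam|) / 2 : ℝ) : ℂ) • (1 : K →L[ℂ] K))) :
    IsUnit B ∧ 0 ≤ -((B ^ 2 - cc lam ^ 2 • 1) * (B ^ 2 - dd lam ^ 2 • 1)) ∧
      Function.Injective (-((B ^ 2 - cc lam ^ 2 • 1) * (B ^ 2 - dd lam ^ 2 • 1)) : K →L[ℂ] K) := by
  have hB : 0 ≤ B := (ContinuousLinearMap.nonneg_iff_isPositive B).2 hBpos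
  have hm : 0 < abs (1 - |lam|) / 2 := by
    have : 1 - |lam| ≠ 0 := by
      intro h
      rcases (abs_eq zero_le_one).1 (sub_eq_zero.1 h).symm with h | h
      · exact hlam.2 h
      · exact hlam.1 h
    positivity
  have hM : 0 < (1 + |lam|) / 2 := by positivity
  have hadd {r : ℝ} (hr : 0 < r) : 0 ≤ B + (r : ℂ) • (1 : K →L[ℂ] K) :=
    add_nonneg hB ((ContinuousLinearMap.nonneg_iff_isPositive _).2
      (ContinuousLinearMap.isPositive_one.smul_of_nonneg (by exact_mod_cast hr.le)))
  have hinj {r : ℝ} (hr : 0 < r) : Function.Injective (B + (r : ℂ) • (1 : K →L[ℂ] K)) := by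
    have : IsUnit (B + (r : ℂ) • (1 : K →L[ℂ] K)) :=
      isUnit_of_smul_one_le hr (by rwa [add_sub_cancel_right])
    exact (ContinuousLinearMap.isUnit_iff_bijective.1 this).injective
  refine ⟨isUnit_of_smul_one_le hm hB₁.1, ?_, ?_⟩
  · rw [P12_radicand_eq]
    refine Commute.mul_nonneg (Commute.mul_nonneg ?_ ?_ ?_)
      (Commute.mul_nonneg (hadd hm) (hadd hM) ?_) ?_
    · exact (ContinuousLinearMap.nonneg_iff_isPositive _).2 hB₁.1
    · exact (ContinuousLinearMap.nonneg_iff_isPositive _).2 hB₂.1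
    all_goals
      simp only [commute_iff_eq, mul_add, add_mul, mul_sub, sub_mul, smul_mul_assoc,
        mul_smul_comm, one_mul, mul_one, mul_assoc]
      match_scalars <;> ring
  · rw [P12_radicand_eq]
    exact (hB₁.2.comp hB₂.2).comp ((hinj hm).comp (hinj hM))

lemma commute_sqrt_radicand {U : K →L[ℂ] K} (h : Commute B U) :
    Commute (CFC.sqrt (-((B ^ 2 - cc lam ^ 2 • 1) * (B ^ 2 - dd lam ^ 2 • 1)))) U := by
  have hz (z : ℂ) : Commute (B ^ 2 - z • 1) U :=
    (h.pow_left 2).sub_left ((Commute.one_left U).smul_left z)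
  exact Commute.cfcₙ_nnreal ((hz _).mul_left (hz _)).neg_left _

lemma commute_P12 {U : K →L[ℂ] K} (h : Commute B U) (hu : IsUnit B) : Commute (P12 lam B) U :=
  (commute_ringInverse h hu).mul_left (commute_sqrt_radicand h)

lemma isSelfAdjoint_P12 (hB : IsSelfAdjoint B) (hu : IsUnit B) : IsSelfAdjoint (P12 lam B) :=
  (IsSelfAdjoint.commute_iff hB.ringInverse (CFC.sqrt_nonneg _).isSelfAdjoint).1
    (commute_ringInverse (commute_sqrt_radicand (Commute.refl B)).symm hu)

lemma P12_mul_self (hu : IsUnit B)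
    (hS : 0 ≤ -((B ^ 2 - cc lam ^ 2 • 1) * (B ^ 2 - dd lam ^ 2 • 1))) :
    P12 lam B * P12 lam B = -(B * B) + (cc lam ^ 2 + dd lam ^ 2) • 1 -
      (cc lam * dd lam) ^ 2 • (Ring.inverse B * Ring.inverse B) := by
  have hc := (commute_ringInverse (commute_sqrt_radicand (lam := lam) (Commute.refl B)).symm hu)
  have h := Ring.inverse_mul_cancel B hu
  have h' (X : K →L[ℂ] K) : Ring.inverse B * (B * X) = X := by rw [← mul_assoc, h, one_mul]
  rw [P12, mul_assoc, ← mul_assoc (CFC.sqrt _), ← hc.eq, mul_assoc, CFC.sqrt_mul_sqrt_self _ hS]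
  simp only [pow_two, mul_sub, sub_mul, smul_mul_assoc, mul_smul_comm, one_mul, mul_one, mul_neg,
    mul_assoc, h, h']
  match_scalars <;> ring

lemma P12_injective (hu : IsUnit B)
    (hS : 0 ≤ -((B ^ 2 - cc lam ^ 2 • 1) * (B ^ 2 - dd lam ^ 2 • 1)))
    (hinj : Function.Injective
      (-((B ^ 2 - cc lam ^ 2 • 1) * (B ^ 2 - dd lam ^ 2 • 1)) : K →L[ℂ] K)) :
    Function.Injective (P12 lam B) := by
  rw [← CFC.sqrt_mul_sqrt_self _ hS] at hinj
  have h₁ : Function.Injective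
      (CFC.sqrt (-((B ^ 2 - cc lam ^ 2 • 1) * (B ^ 2 - dd lam ^ 2 • 1))) : K →L[ℂ] K) :=
    Function.Injective.of_comp (f := (CFC.sqrt _ : K →L[ℂ] K)) hinj
  exact (ContinuousLinearMap.isUnit_iff_bijective.1 hu.ringInverse).injective.comp h₁

lemma sub_mul_self_add_P12_mul_self (hu : IsUnit B)
    (hS : 0 ≤ -((B ^ 2 - cc lam ^ 2 • 1) * (B ^ 2 - dd lam ^ 2 • 1))) :
    (B - (cc lam * dd lam) • Ring.inverse B) * (B - (cc lam * dd lam) • Ring.inverse B) +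
      P12 lam B * P12 lam B = ((lam : ℂ) ^ 2) • 1 := by
  rw [P12_mul_self hu hS, ← cc_sub_dd]
  simp only [mul_sub, sub_mul, smul_mul_assoc, mul_smul_comm, Ring.inverse_mul_cancel B hu,
    Ring.mul_inverse_cancel B hu]
  match_scalars <;> ring

lemma add_mul_self_add_P12_mul_self (hu : IsUnit B)
    (hS : 0 ≤ -((B ^ 2 - cc lam ^ 2 • 1) * (B ^ 2 - dd lam ^ 2 • 1))) :
    (B + (cc lam * dd lam) • Ring.inverse B) * (B + (cc lam * dd lam) • Ring.inverse B) +
      P12 lam B * P12 lam B = (1 : K →L[ℂ] K) := by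
  have h1 : (1 : K →L[ℂ] K) = ((cc lam + dd lam) ^ 2) • 1 := by simp [cc_add_dd]
  conv_rhs => rw [h1]
  rw [P12_mul_self hu hS]
  simp only [mul_add, add_mul, smul_mul_assoc, mul_smul_comm, Ring.inverse_mul_cancel B hu,
    Ring.mul_inverse_cancel B hu]
  match_scalars <;> ring

lemma isSelfAdjoint_cc_mul_dd_smul (hB : IsSelfAdjoint B) :
    IsSelfAdjoint ((cc lam * dd lam) • Ring.inverse B) := by
  rw [IsSelfAdjoint, star_smul, hB.ringInverse.star_eq, cc, dd, ← Complex.ofReal_mul]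
  simp

lemma smul_PU_add_QU (hlam : lam ≠ 0) (hu : IsUnit B) (U : K →L[ℂ] K) :
    (lam : ℂ) • PU lam B U + QU lam B U = blk B 0 0 (-B) + cc lam • 1 := by
  have hlam' : (lam : ℂ) ≠ 0 := by exact_mod_cast hlam
  rw [PU, QU, P11_eq hu, P22_eq hu, Q11_eq hu, Q22_eq hu, ← blk_one]
  simp only [blk_smul, blk_add, cc_eq]
  push_cast
  congr 1 <;> match_scalars <;> field_simp <;> ring

lemma isOrthoProj_PU (hlam : lam ≠ 0) (hB : IsSelfAdjoint B) (hu : IsUnit B)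
    (hS : 0 ≤ -((B ^ 2 - cc lam ^ 2 • 1) * (B ^ 2 - dd lam ^ 2 • 1)))
    {U : K →L[ℂ] K} (hU : U ∈ unitary (K →L[ℂ] K)) (hUB : Commute U B) :
    IsOrthoProj (PU lam B U) := by
  rw [PU, P11_eq hu, P22_eq hu]
  exact isOrthoProj_blk hlam (hB.sub (isSelfAdjoint_cc_mul_dd_smul hB)) (isSelfAdjoint_P12 hB hu)
    (commute_sub_smul_ringInverse (commute_P12 (Commute.refl B) hu).symm hu _)
    (commute_sub_smul_ringInverse hUB.symm hu _) (commute_P12 hUB.symm hu) hU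
    (sub_mul_self_add_P12_mul_self hu hS)

lemma isOrthoProj_QU (hB : IsSelfAdjoint B) (hu : IsUnit B)
    (hS : 0 ≤ -((B ^ 2 - cc lam ^ 2 • 1) * (B ^ 2 - dd lam ^ 2 • 1)))
    {U : K →L[ℂ] K} (hU : U ∈ unitary (K →L[ℂ] K)) (hUB : Commute U B) :
    IsOrthoProj (QU lam B U) := by
  have hcomm {V : K →L[ℂ] K} (h : Commute B V) :
      Commute (B + (cc lam * dd lam) • Ring.inverse B) V :=
    h.add_left ((commute_ringInverse h hu).smul_left _)
  have h := isOrthoProj_blk (N := -P12 lam B) one_ne_zero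
    (hB.add (isSelfAdjoint_cc_mul_dd_smul (lam := lam) hB)) (isSelfAdjoint_P12 hB hu).neg
    (hcomm (commute_P12 (Commute.refl B) hu).symm).neg_right
    (hcomm hUB.symm) (commute_P12 hUB.symm hu).neg_left hU
    (by rw [neg_mul_neg, add_mul_self_add_P12_mul_self hu hS]; simp)
  rw [QU, Q11_eq hu, Q22_eq hu]
  simpa using h

/-- If `P` and `T - λP` are idempotent then `T² - T = λ(TP + PT) - λ(λ + 1)P`, which for
`T = D + (1+λ)/2` reads `λ(DP + PD) = D² + λD - cd`. -/
lemma smul_anticommutator_eq {H : Type*} [NormedAddCommGroup H] [NormedSpace ℂ H]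
    {D P Q : H →L[ℂ] H} (hP : P * P = P) (hQ : Q * Q = Q)
    (h : D + cc lam • 1 = (lam : ℂ) • P + Q) :
    (lam : ℂ) • (D * P + P * D) = D * D + (lam : ℂ) • D - (cc lam * dd lam) • 1 := by
  obtain rfl : Q = D + cc lam • 1 - (lam : ℂ) • P := eq_sub_of_add_eq' h.symm
  rw [← sub_eq_zero] at hQ ⊢
  rw [← neg_eq_zero, ← hQ]
  simp only [mul_add, add_mul, mul_sub, sub_mul, smul_mul_assoc, mul_smul_comm, one_mul, mul_one,
    hP, cc_eq, dd_eq]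
  match_scalars <;> ring

end Entries

/-- For `λ ∈ ℝ \ {−1,0,1}` and `T = (B ⊕ (−B)) + ((1+λ)/2)·I` with
`(|1−|λ||/2)·I < B < ((1+|λ|)/2)·I`, the pairs of projections `(P, Q)` with `T = λP + Q`
are exactly the pairs `(P_U, Q_U)` for unitaries `U` commuting with `B`. -/
theorem pencil_pairs_generic_classification (lam : ℝ)
    (hlam : lam ≠ -1 ∧ lam ≠ 0 ∧ lam ≠ 1)
    (B : K →L[ℂ] K) (hBpos : B.IsPositive)
    (hB₁ : OpLt (((abs (1 - |lam|) / 2 : ℝ) : ℂ) • (1 : K →L[ℂ] K)) B)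
    (hB₂ : OpLt B ((((1 + |lam|) / 2 : ℝ) : ℂ) • (1 : K →L[ℂ] K)))
    (T : WithLp 2 (K × K) →L[ℂ] WithLp 2 (K × K))
    (hT : T = blk B 0 0 (-B) + cc lam • 1) :
    (∀ U : K →L[ℂ] K, U ∈ unitary (K →L[ℂ] K) → Commute U B →
      IsOrthoProj (PU lam B U) ∧ IsOrthoProj (QU lam B U) ∧
        (lam : ℂ) • PU lam B U + QU lam B U = T) ∧
    (∀ P Q : WithLp 2 (K × K) →L[ℂ] WithLp 2 (K × K),
      IsOrthoProj P → IsOrthoProj Q → T = (lam : ℂ) • P + Q →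
      ∃ U ∈ unitary (K →L[ℂ] K), Commute U B ∧ P = PU lam B U ∧ Q = QU lam B U) := by
  obtain ⟨hl₁, hl₀, hl₂⟩ := hlam
  obtain ⟨hu, hS, hSinj⟩ := isUnit_and_radicand_nonneg_injective ⟨hl₁, hl₂⟩ hBpos hB₁ hB₂
  have hB := hBpos.isSelfAdjoint
  subst hT
  refine ⟨fun U hU hUB => ⟨isOrthoProj_PU hl₀ hB hu hS hU hUB, isOrthoProj_QU hB hu hS hU hUB,
    smul_PU_add_QU hl₀ hu U⟩, fun P Q hP hQ hPQ => ?_⟩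
  have hPB := smul_anticommutator_eq hP.2 hQ.2 hPQ
  obtain ⟨U, hU, hUB, hPU⟩ := exists_unitary_of_anticommutator hl₀
    ((ContinuousLinearMap.nonneg_iff_isPositive B).2 hBpos) hu
    (commute_sub_smul_ringInverse (Commute.refl B) hu (cc lam * dd lam)).symm
    (commute_P12 (lam := lam) (Commute.refl B) hu).symm (isSelfAdjoint_P12 hB hu)
    (P12_injective hu hS hSinj) (sub_mul_self_add_P12_mul_self hu hS) hP
    (by
      rw [hPB, ← blk_one, sub_eq_add_neg, ← neg_smul]
      simp only [blk_mul, blk_smul, blk_add, mul_add, mul_sub, mul_smul_comm, mul_one,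
        Ring.mul_inverse_cancel B hu, zero_mul, mul_zero, neg_mul, mul_neg]
      congr 1 <;> match_scalars <;> ring)
  rw [← P11_eq hu, ← P22_eq hu] at hPU
  refine ⟨U, hU, hUB, hPU, ?_⟩
  rw [← smul_PU_add_QU hl₀ hu U, hPU] at hPQ
  exact (add_left_cancel hPQ).symm
end
end

section
/- Let λ ∈ ℝ \ {−1, 0, 1}, let P, Q be orthogonal projections on a complex Hilbert space H, and set T = λP + Q. If P₁, Q₁ are orthogonal projections on H with T = λP₁ + Q₁, then there exists a unitary U ∈ B(H) commuting with T such that UPU* = P₁ and UQU* = Q₁. -/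
section UnitaryEquivalence

variable {H : Type*} [NormedAddCommGroup H] [InnerProductSpace ℂ H] [CompleteSpace H]

/-- The range and the kernel of a self-adjoint operator together span a dense subspace. -/
lemma IsSelfAdjoint.denseRange_coprod_ker_subtype {X : H →L[ℂ] H} (hX : IsSelfAdjoint X) :
    DenseRange ((X : H →ₗ[ℂ] H).coprod X.ker.subtype) := by
  have h : (LinearMap.range ((X : H →ₗ[ℂ] H).coprod X.ker.subtype)).topologicalClosure = ⊤ := by
    rw [Submodule.topologicalClosure_eq_top_iff, LinearMap.range_coprod, ← Submodule.inf_orthogonal,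
      Submodule.range_subtype, ContinuousLinearMap.IsStarNormal.orthogonal_range hX.isStarNormal,
      Submodule.inf_orthogonal_eq_bot]
  rw [← Submodule.dense_iff_topologicalClosure_eq_top] at h
  rwa [DenseRange, ← LinearMap.coe_range]

lemma IsSelfAdjoint.norm_add_sq_of_mem_ker {X : H →L[ℂ] H} (hX : IsSelfAdjoint X) (x : H) {k : H}
    (hk : X k = 0) : ‖X x + k‖ ^ 2 = ‖X x‖ ^ 2 + ‖k‖ ^ 2 := by
  have h : inner ℂ (X x) k = 0 := by
    rw [show inner ℂ (X x) k = inner ℂ x (X k) from hX.isSymmetric x k, hk, inner_zero_right]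
  simp only [pow_two]
  exact norm_add_sq_eq_norm_sq_add_norm_sq_of_inner_eq_zero _ _ h

/-- Self-adjoint operators with equal squares differ by a unitary factor acting trivially on
their common kernel. -/
lemma exists_unitary_mul_eq_of_mul_self_eq {X Y : H →L[ℂ] H} (hX : IsSelfAdjoint X)
    (hY : IsSelfAdjoint Y) (h : X * X = Y * Y) :
    ∃ W ∈ unitary (H →L[ℂ] H), W * X = Y ∧ ∀ k, X k = 0 → W k = k := by
  have hnorm (x : H) : ‖X x‖ = ‖Y x‖ := by
    have key (Z : H →L[ℂ] H) (hZ : IsSelfAdjoint Z) : inner ℂ (Z x) (Z x) = inner ℂ x ((Z * Z) x) :=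
      hZ.isSymmetric x (Z x)
    have := (key X hX).trans ((congrArg (fun Z : H →L[ℂ] H => inner ℂ x (Z x)) h).trans
      (key Y hY).symm)
    rw [inner_self_eq_norm_sq_to_K, inner_self_eq_norm_sq_to_K] at this
    have h2 : ‖X x‖ ^ 2 = ‖Y x‖ ^ 2 := by exact_mod_cast this
    exact (pow_left_inj₀ (norm_nonneg _) (norm_nonneg _) two_ne_zero).mp h2
  have hker : X.ker = Y.ker := by
    ext x
    change X x = 0 ↔ Y x = 0
    rw [← norm_eq_zero, hnorm, norm_eq_zero]
  have hdX := hX.denseRange_coprod_ker_subtype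
  have hdY := hY.denseRange_coprod_ker_subtype
  rw [← hker] at hdY
  let f := LinearEquiv.refl ℂ (H × X.ker)
  have hf (p : H × X.ker) : ‖(Y : H →ₗ[ℂ] H).coprod X.ker.subtype (f p)‖ =
      ‖(X : H →ₗ[ℂ] H).coprod X.ker.subtype p‖ := by
    obtain ⟨x, k, hk⟩ := p
    have hk' : Y k = 0 := by rw [hker] at hk; exact hk
    refine (pow_left_inj₀ (norm_nonneg _) (norm_nonneg _) two_ne_zero).mp ?_
    change ‖Y x + k‖ ^ 2 = ‖X x + k‖ ^ 2
    rw [hX.norm_add_sq_of_mem_ker x hk, hY.norm_add_sq_of_mem_ker x hk', hnorm]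
  let V := f.extendOfIsometry _ _ hdX hdY hf
  have hV (x k : H) (hk : X k = 0) : V (X x + k) = Y x + k :=
    f.extendOfIsometry_eq _ _ hdX hdY hf (x, ⟨k, hk⟩)
  refine ⟨(Unitary.linearIsometryEquiv.symm V : unitary (H →L[ℂ] H)), Subtype.property _, ?_, ?_⟩
  · ext x
    simpa using hV x 0 (map_zero X)
  · intro k hk
    simpa using hV 0 k hk

/-- A unitary carrying `X` to `Y` and acting trivially on `ker X` commutes with every self-adjoint
operator that anticommutes with both `X` and `Y`. -/
lemma commute_of_mul_eq_neg_mul {X Y W A : H →L[ℂ] H} (hX : IsSelfAdjoint X)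
    (hWX : W * X = Y) (hW : ∀ k, X k = 0 → W k = k)
    (hAX : A * X = -(X * A)) (hAY : A * Y = -(Y * A)) : Commute W A := by
  have h : ∀ y, (W * A) y = (A * W) y := by
    refine hX.denseRange_coprod_ker_subtype.induction ?_
      (isClosed_eq (W * A).continuous (A * W).continuous)
    rintro _ ⟨⟨x, k, hk⟩, rfl⟩
    change W (A (X x + k)) = A (W (X x + k))
    have h1 : A (X x) = -X (A x) := congrArg (· x) hAX
    have h2 : A (Y x) = -Y (A x) := congrArg (· x) hAY
    have h3 (z : H) : W (X z) = Y z := congrArg (· z) hWX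
    have h4 : X (A k) = 0 := by
      have : A (X k) = -X (A k) := congrArg (· k) hAX
      rw [show X k = 0 from hk, map_zero] at this
      exact neg_eq_zero.mp this.symm
    simp only [map_add, h1, h3, map_neg, h2, hW k hk, hW _ h4]
  exact ContinuousLinearMap.ext h

/-- The sign of an invertible self-adjoint operator. -/
lemma exists_symmetry_of_isUnit {A : H →L[ℂ] H} (hA : IsSelfAdjoint A) (hu : IsUnit A) :
    ∃ G : H →L[ℂ] H, IsSelfAdjoint G ∧ G * G = 1 ∧ (∀ Y, Commute Y A → Commute Y G) ∧
      ∀ Y, A * Y = -(Y * A) → G * Y = -(Y * G) := by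
  set B := CFC.abs A with hB
  have hBB : B * B = A * A := by rw [hB, CFC.abs_mul_abs, hA.star_eq]
  have hBA : Commute B A := CFC.commute_abs_self A
  have hBs : IsSelfAdjoint B := (CFC.abs_nonneg A).isSelfAdjoint
  have hcomm (Y : H →L[ℂ] H) (hY : Commute (A * A) Y) : Commute B Y := by
    refine Commute.cfcₙ_nnreal ?_ _
    rwa [hA.star_eq]
  have hBu : IsUnit B := by
    have : IsUnit (B * B) := hBB ▸ hu.mul hu
    exact ((Commute.refl B).isUnit_mul_iff.mp this).1
  obtain ⟨b, hb⟩ := hBu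
  have hC (Y : H →L[ℂ] H) (hY : Commute B Y) : Commute (↑b⁻¹ : H →L[ℂ] H) Y :=
    Commute.units_inv_left (hb ▸ hY)
  set C : H →L[ℂ] H := ↑b⁻¹
  have hBC : B * C = 1 := by rw [← hb]; exact b.mul_inv
  have hCB : C * B = 1 := by rw [← hb]; exact b.inv_mul
  have hCA := hC A hBA
  have hCs : IsSelfAdjoint C := by
    have : star C * B = 1 := by rw [← hBs.star_eq, ← star_mul, hBC, star_one]
    calc star C = star C * (B * C) := by rw [hBC, mul_one]
      _ = C := by rw [← mul_assoc, this, one_mul]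
  refine ⟨C * A, ?_, ?_, ?_, ?_⟩
  · rw [isSelfAdjoint_iff, star_mul, hCs.star_eq, hA.star_eq, hCA.eq]
  · calc C * A * (C * A) = C * (A * C) * A := by simp only [mul_assoc]
      _ = C * C * (A * A) := by rw [← hCA.eq]; simp only [mul_assoc]
      _ = C * (C * B) * B := by rw [← hBB]; simp only [mul_assoc]
      _ = 1 := by rw [hCB, mul_one, hCB]
  · intro Y hY
    exact ((hC Y (hcomm Y (hY.symm.mul_left hY.symm))).symm).mul_right hY
  · intro Y hY
    have h : Commute (A * A) Y := by
      change A * A * Y = Y * (A * A)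
      rw [mul_assoc, hY, mul_neg, ← mul_assoc, hY, neg_mul, neg_neg, mul_assoc]
    rw [mul_assoc, hY, mul_neg, ← mul_assoc, (hC Y (hcomm Y h)).eq, mul_assoc]

/-- Self-adjoint operators with equal squares that anticommute with a common invertible
self-adjoint operator `A` are unitarily equivalent through the commutant of `A`. -/
lemma exists_unitary_commute_of_anticommute {A X Y : H →L[ℂ] H} (hA : IsSelfAdjoint A)
    (hu : IsUnit A) (hX : IsSelfAdjoint X) (hY : IsSelfAdjoint Y) (h : X * X = Y * Y)
    (hAX : A * X = -(X * A)) (hAY : A * Y = -(Y * A)) :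
    ∃ U ∈ unitary (H →L[ℂ] H), Commute U A ∧ U * X = Y * U := by
  obtain ⟨W, hWu, hWX, hWk⟩ := exists_unitary_mul_eq_of_mul_self_eq hX hY h
  obtain ⟨G, hGs, hGG, hGc, hGa⟩ := exists_symmetry_of_isUnit hA hu
  have hWA := commute_of_mul_eq_neg_mul hX hWX hWk hAX hAY
  have hWG := hGc W hWA
  have hAG := hGc A (Commute.refl A)
  have hGX := hGa X hAX
  have hGY := hGa Y hAY
  have hYW : Y * W = X := by
    have : X * star W = Y := by
      rw [← hX.star_eq, ← star_mul, hWX, hY.star_eq]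
    rw [← this, mul_assoc, Unitary.star_mul_self_of_mem hWu, mul_one]
  set E : H →L[ℂ] H := (2⁻¹ : ℂ) • (1 + G) with hE
  set F : H →L[ℂ] H := (2⁻¹ : ℂ) • (1 - G) with hF
  have hEs : star E = E := by simp [hE, star_smul, hGs.star_eq]
  have hFs : star F = F := by simp [hF, star_smul, hGs.star_eq]
  have hEF : E + F = 1 := by rw [hE, hF]; module
  have hEFm : E * F = 0 := by
    simp only [hE, hF, smul_mul_assoc, mul_smul_comm, mul_sub, add_mul, mul_one, one_mul, hGG]
    module
  have hFEm : F * E = 0 := by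
    simp only [hE, hF, smul_mul_assoc, mul_smul_comm, mul_add, sub_mul, mul_one, one_mul, hGG]
    module
  have hEE : E * E = E := by
    calc E * E = E * (E + F) := by rw [mul_add, hEFm, add_zero]
      _ = E := by rw [hEF, mul_one]
  have hFF : F * F = F := by
    calc F * F = (E + F) * F := by rw [add_mul, hEFm, zero_add]
      _ = F := by rw [hEF, one_mul]
  have hEA : E * A = A * E := by simp [hE, mul_add, add_mul, hAG.eq]
  have hFA : F * A = A * F := by simp [hF, mul_sub, sub_mul, hAG.eq]
  have hFW : F * W = W * F := by simp [hF, mul_sub, sub_mul, hWG.eq]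
  have hFWs : F * star W = star W * F := by
    have := congrArg star hFW
    rw [star_mul, star_mul, hFs] at this
    exact this.symm
  have hYE : Y * E = F * Y := by simp [hE, hF, mul_add, sub_mul, hGY]
  have hYF : Y * F = E * Y := by
    simp only [hE, hF, smul_mul_assoc, mul_smul_comm, mul_sub, add_mul, mul_one, one_mul, hGY]
    module
  refine ⟨E + F * W, ?_, ?_, ?_⟩
  · have hs : star (E + F * W) = E + F * star W := by
      rw [star_add, star_mul, hEs, hFs, hFWs]
    have key (V V' : H →L[ℂ] H) (hV : F * V = V * F) (hVV : V * V' = 1) :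
        (E + F * V) * (E + F * V') = 1 := by
      calc (E + F * V) * (E + F * V')
          = E * E + (E * F) * V' + V * (F * E) + V * (F * F) * V' := by
            rw [hV]; simp only [mul_add, add_mul, mul_assoc]; abel
        _ = E + F * (V * V') := by
            rw [hEE, hEFm, hFEm, hFF, ← hV]; simp [mul_assoc]
        _ = 1 := by rw [hVV, mul_one, hEF]
    rw [Unitary.mem_iff, hs]
    exact ⟨key _ _ hFWs (Unitary.star_mul_self_of_mem hWu),
      key _ _ hFW (Unitary.mul_star_self_of_mem hWu)⟩
  · change (E + F * W) * A = A * (E + F * W)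
    rw [add_mul, mul_add, hEA, mul_assoc, hWA.eq, ← mul_assoc, hFA, mul_assoc]
  · rw [add_mul, mul_add, hYE, mul_assoc, hWX, ← mul_assoc, hYF, mul_assoc, hYW, add_comm]

lemma isUnit_smul_add_of_mul_self_eq_one {S R : H →L[ℂ] H} (hS : IsSelfAdjoint S)
    (hR : IsSelfAdjoint R) (hSS : S * S = 1) (hRR : R * R = 1) {c : ℂ} (hc : ‖c‖ ≠ 1) :
    IsUnit (c • S + R) := by
  have hSR : S * R ∈ unitary (H →L[ℂ] H) := by
    rw [Unitary.mem_iff, star_mul, hS.star_eq, hR.star_eq]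
    constructor
    · rw [mul_assoc, ← mul_assoc S, hSS, one_mul, hRR]
    · rw [mul_assoc, ← mul_assoc R, hRR, one_mul, hSS]
  have hu : IsUnit (algebraMap ℂ (H →L[ℂ] H) (-c) - S * R) := by
    by_contra h
    have := spectrum.subset_circle_of_unitary hSR (spectrum.mem_iff.mpr h)
    exact hc (by simpa using this)
  have h : c • S + R = -(S * (algebraMap ℂ (H →L[ℂ] H) (-c) - S * R)) := by
    rw [mul_sub, ← mul_assoc, hSS, one_mul, Algebra.algebraMap_eq_smul_one]
    simp [add_comm]
  rw [h]
  exact ((isUnit_iff_exists.mpr ⟨S, hSS, hSS⟩).mul hu).neg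

/-- The part of a symmetry `S` that anticommutes with `A = c • S + R`, where `R` is a second
symmetry and `J = A⁻¹`. -/
lemma anticommutingPart_properties {S R A J : H →L[ℂ] H} {c : ℂ} (hc : c ≠ 0)
    (hSS : S * S = 1) (hRR : R * R = 1) (hA : A = c • S + R) (hAJ : A * J = 1) (hJA : J * A = 1) :
    let B := (2 * c)⁻¹ • (A + (c ^ 2 - 1) • J)
    A * (S - B) = -((S - B) * A) ∧ (S - B) * (S - B) = 1 - B * B := by
  intro B
  have hR : R = A - c • S := by rw [hA]; abel
  have hanti : c • (A * S + S * A) = A * A + (c ^ 2 - 1) • (1 : H →L[ℂ] H) := by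
    rw [hR] at hRR
    simp only [mul_sub, sub_mul, smul_mul_assoc, mul_smul_comm, hSS] at hRR
    linear_combination (norm := module) (-1 : ℂ) • hRR
  have hAB : A * B = (2 * c)⁻¹ • (A * A + (c ^ 2 - 1) • (1 : H →L[ℂ] H)) := by
    simp only [B, mul_smul_comm, mul_add, hAJ]
  have hBA : B * A = (2 * c)⁻¹ • (A * A + (c ^ 2 - 1) • (1 : H →L[ℂ] H)) := by
    simp only [B, smul_mul_assoc, add_mul, hJA]
  have h1 : A * (S - B) = -((S - B) * A) := by
    rw [mul_sub, sub_mul, hAB, hBA, ← hanti, smul_smul]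
    have : (2 * c)⁻¹ * c = 2⁻¹ := by field_simp
    rw [this]
    module
  have h2 : J * (S - B) = -((S - B) * J) := by
    calc J * (S - B) = J * ((S - B) * A) * J := by rw [mul_assoc, mul_assoc, hAJ, mul_one]
      _ = -((J * A) * (S - B) * J) := by
        rw [show (S - B) * A = -(A * (S - B)) by rw [h1, neg_neg]]
        simp only [mul_neg, neg_mul, mul_assoc]
      _ = -((S - B) * J) := by rw [hJA, one_mul]
  have h3 : B * (S - B) = -((S - B) * B) := by
    change ((2 * c)⁻¹ • (A + (c ^ 2 - 1) • J)) * (S - B) =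
      -((S - B) * ((2 * c)⁻¹ • (A + (c ^ 2 - 1) • J)))
    rw [smul_mul_assoc, add_mul, smul_mul_assoc, h1, h2, mul_smul_comm, mul_add, mul_smul_comm]
    module
  refine ⟨h1, ?_⟩
  calc (S - B) * (S - B) = S * S - B * B - (B * (S - B) + (S - B) * B) := by noncomm_ring
    _ = 1 - B * B := by rw [h3, hSS]; abel

/-- Two pairs of symmetries in the same pencil are unitarily equivalent. -/
lemma exists_unitary_of_symmetry_pencil {S R S₁ R₁ A : H →L[ℂ] H} {c : ℝ} (hc0 : c ≠ 0)
    (hc1 : |c| ≠ 1) (hS : IsSelfAdjoint S) (hR : IsSelfAdjoint R) (hS₁ : IsSelfAdjoint S₁)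
    (hSS : S * S = 1) (hRR : R * R = 1) (hSS₁ : S₁ * S₁ = 1) (hRR₁ : R₁ * R₁ = 1)
    (hA : A = (c : ℂ) • S + R) (hA₁ : A = (c : ℂ) • S₁ + R₁) :
    ∃ U ∈ unitary (H →L[ℂ] H), Commute U A ∧ U * S = S₁ * U := by
  have hcC : (c : ℂ) ≠ 0 := by exact_mod_cast hc0
  have hu : IsUnit A := by
    rw [hA]
    exact isUnit_smul_add_of_mul_self_eq_one hS hR hSS hRR (by simpa using hc1)
  have hAs : IsSelfAdjoint A := by
    rw [isSelfAdjoint_iff, hA, star_add, star_smul, hS.star_eq, hR.star_eq]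
    simp
  obtain ⟨a, ha⟩ := hu
  set J : H →L[ℂ] H := ↑a⁻¹
  have hAJ : A * J = 1 := by rw [← ha]; exact a.mul_inv
  have hJA : J * A = 1 := by rw [← ha]; exact a.inv_mul
  have hJs : IsSelfAdjoint J := by
    have : star J * A = 1 := by rw [← hAs.star_eq, ← star_mul, hAJ, star_one]
    calc star J = star J * (A * J) := by rw [hAJ, mul_one]
      _ = J := by rw [← mul_assoc, this, one_mul]
  obtain ⟨hX1, hX2⟩ := anticommutingPart_properties hcC hSS hRR hA hAJ hJA
  obtain ⟨hY1, hY2⟩ := anticommutingPart_properties hcC hSS₁ hRR₁ hA₁ hAJ hJA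
  set B := (2 * (c : ℂ))⁻¹ • (A + ((c : ℂ) ^ 2 - 1) • J) with hB
  have hBs : IsSelfAdjoint B := by
    rw [isSelfAdjoint_iff, hB, star_smul, star_add, star_smul, hAs.star_eq, hJs.star_eq]
    simp
  obtain ⟨U, hU, hUA, hUX⟩ := exists_unitary_commute_of_anticommute hAs ⟨a, ha⟩ (hS.sub hBs)
    (hS₁.sub hBs) (hX2.trans hY2.symm) hX1 hY1
  have hUJ : Commute U J := Commute.units_inv_right (ha ▸ hUA)
  have hUB : U * B = B * U := ((hUA.add_right (hUJ.smul_right _)).smul_right _).eq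
  refine ⟨U, hU, hUA, ?_⟩
  rw [mul_sub, sub_mul, hUB] at hUX
  exact sub_left_inj.mp hUX

lemma IsOrthoProj.isSelfAdjoint_two_smul_sub_one {P : H →L[ℂ] H} (hP : IsOrthoProj P) :
    IsSelfAdjoint ((2 : ℂ) • P - 1) := by
  rw [isSelfAdjoint_iff, star_sub, star_smul, hP.1.star_eq, star_one]
  simp

lemma IsOrthoProj.two_smul_sub_one_mul_self {P : H →L[ℂ] H} (hP : IsOrthoProj P) :
    ((2 : ℂ) • P - 1) * ((2 : ℂ) • P - 1) = 1 := by
  simp only [mul_sub, sub_mul, smul_mul_assoc, mul_smul_comm, hP.2, mul_one, one_mul]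
  module

end UnitaryEquivalence


/-- For `λ ∈ ℝ \ {−1, 0, 1}`, any two pairs of projections `(P, Q)` and `(P₁, Q₁)` with
`λP + Q = λP₁ + Q₁` are simultaneously unitarily equivalent via a unitary commuting with
`T = λP + Q`. -/
theorem pencil_pairs_unitarily_equivalent {H : Type*} [NormedAddCommGroup H]
    [InnerProductSpace ℂ H] [CompleteSpace H]
    (lam : ℝ) (hlam : lam ≠ -1 ∧ lam ≠ 0 ∧ lam ≠ 1)
    (P Q P₁ Q₁ : H →L[ℂ] H)
    (hP : IsOrthoProj P) (hQ : IsOrthoProj Q)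
    (hP₁ : IsOrthoProj P₁) (hQ₁ : IsOrthoProj Q₁)
    (T : H →L[ℂ] H) (hT : T = (lam : ℂ) • P + Q)
    (hT₁ : T = (lam : ℂ) • P₁ + Q₁) :
    ∃ U ∈ unitary (H →L[ℂ] H), Commute U T ∧
      U * P * star U = P₁ ∧ U * Q * star U = Q₁ := by
  obtain ⟨hm1, h0, h1⟩ := hlam
  have habs : |lam| ≠ 1 := fun h => (eq_or_eq_neg_of_abs_eq h).elim h1 hm1
  have hA : (2 : ℂ) • T - ((lam : ℂ) + 1) • (1 : H →L[ℂ] H) =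
      (lam : ℂ) • ((2 : ℂ) • P - 1) + ((2 : ℂ) • Q - 1) := by
    rw [hT]; module
  have hA₁ : (2 : ℂ) • T - ((lam : ℂ) + 1) • (1 : H →L[ℂ] H) =
      (lam : ℂ) • ((2 : ℂ) • P₁ - 1) + ((2 : ℂ) • Q₁ - 1) := by
    rw [hT₁]; module
  obtain ⟨U, hU, hUA, hUS⟩ := exists_unitary_of_symmetry_pencil h0 habs
    hP.isSelfAdjoint_two_smul_sub_one hQ.isSelfAdjoint_two_smul_sub_one
    hP₁.isSelfAdjoint_two_smul_sub_one hP.two_smul_sub_one_mul_self hQ.two_smul_sub_one_mul_self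
    hP₁.two_smul_sub_one_mul_self hQ₁.two_smul_sub_one_mul_self hA hA₁
  have hUP : U * P = P₁ * U := by
    rw [mul_sub, sub_mul, mul_one, one_mul, sub_left_inj, mul_smul_comm, smul_mul_assoc] at hUS
    exact smul_right_injective _ (two_ne_zero' ℂ) hUS
  have hUT : U * T = T * U := by
    have h := hUA.eq
    rw [mul_sub, sub_mul, mul_smul_comm, smul_mul_assoc, mul_smul_comm, smul_mul_assoc, mul_one,
      one_mul, sub_left_inj] at h
    exact smul_right_injective _ (two_ne_zero' ℂ) h
  have hUQ : U * Q = Q₁ * U := by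
    have hQT : Q = T - (lam : ℂ) • P := by rw [hT]; abel
    have hQT₁ : Q₁ = T - (lam : ℂ) • P₁ := by rw [hT₁]; abel
    rw [hQT, hQT₁, mul_sub, sub_mul, hUT, mul_smul_comm, smul_mul_assoc, hUP]
  have hUU := Unitary.mul_star_self_of_mem hU
  exact ⟨U, hU, hUT, by rw [hUP, mul_assoc, hUU, mul_one], by rw [hUQ, mul_assoc, hUU, mul_one]⟩
end

section
/- Let λ ∈ ℝ \ {−1, 0, 1} and let (P, Q) and (P₁, Q₁) be pairs of orthogonal projections on a complex Hilbert space H. Then there exists a unitary U ∈ B(H) with UPU* = P₁ and UQU* = Q₁ if and only if the operators λP + Q and λP₁ + Q₁ are unitarily equivalent (i.e., V(λP + Q)V* = λP₁ + Q₁ for some unitary V ∈ B(H)). -/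
open scoped InnerProductSpace

section Algebra

variable {A : Type*} [Ring A] {R M b : A}

theorem commute_sq_of_anticommutator_eq (hb : R * M + M * R = b) (hbM : Commute b M) :
    Commute R (M * M) := by
  have h := hbM.eq
  subst hb
  rw [← sub_eq_zero] at h
  rw [commute_iff_eq, ← sub_eq_zero, ← h]
  noncomm_ring

theorem commutator_mul_commutator (hR : R * R = 1) (hb : R * M + M * R = b) (hbM : Commute b M) :
    (R * M - M * R) * (R * M - M * R) = b * b - 4 * (M * M) := by
  have h := (commute_sq_of_anticommutator_eq hb hbM).eq
  have h1 : R * M * (M * R) = M * M := by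
    calc R * M * (M * R) = R * (M * M) * R := by noncomm_ring
      _ = M * M * (R * R) := by rw [h]; noncomm_ring
      _ = M * M := by rw [hR, mul_one]
  have h2 : M * R * (R * M) = M * M := by
    calc M * R * (R * M) = M * (R * R) * M := by noncomm_ring
      _ = M * M := by rw [hR, mul_one]
  subst hb
  calc (R * M - M * R) * (R * M - M * R)
      = (R * M + M * R) * (R * M + M * R) - 2 * (R * M * (M * R)) - 2 * (M * R * (R * M)) := by
        noncomm_ring
    _ = _ := by rw [h1, h2]; noncomm_ring

theorem commutator_anticommute (hRM : Commute R (M * M)) :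
    M * (R * M - M * R) = -((R * M - M * R) * M) := by
  have h := hRM.eq
  calc M * (R * M - M * R) = M * R * M - M * M * R := by noncomm_ring
    _ = M * R * M - R * (M * M) := by rw [h]
    _ = _ := by noncomm_ring

theorem commute_sq_of_anticommute {X : A} (h : M * X = -(X * M)) : Commute X (M * M) := by
  rw [commute_iff_eq, mul_assoc, h, mul_neg, ← mul_assoc M X M, h, neg_mul, neg_neg, mul_assoc]

/-- If `J` is an involution and `Z` commutes with it, then `1 + J + Z (1 - J)` is twice
an invertible element, with inverse obtained from an inverse of `Z`. -/
theorem one_add_add_mul_one_sub_mul {J Z Z' : A} (hJ : J * J = 1) (hZZ' : Z * Z' = 1) (hZ : Commute Z J) :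
    (1 + J + Z * (1 - J)) * (1 + J + (1 - J) * Z') = 4 := by
  have hF : Commute Z (1 - J) := (Commute.one_right Z).sub_right hZ
  have hEE : (1 + J) * (1 + J) = 2 * (1 + J) := by
    calc (1 + J) * (1 + J) = 1 + 2 * J + J * J := by noncomm_ring
      _ = _ := by rw [hJ]; noncomm_ring
  have hFF : (1 - J) * (1 - J) = 2 * (1 - J) := by
    calc (1 - J) * (1 - J) = 1 - 2 * J + J * J := by noncomm_ring
      _ = _ := by rw [hJ]; noncomm_ring
  have hEF : (1 + J) * (1 - J) = 0 := by
    calc (1 + J) * (1 - J) = 1 - J * J := by noncomm_ring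
      _ = _ := by rw [hJ, sub_self]
  have hFE : (1 - J) * (1 + J) = 0 := by
    calc (1 - J) * (1 + J) = 1 - J * J := by noncomm_ring
      _ = _ := by rw [hJ, sub_self]
  have h22 : 2 * (1 + J) + 2 * (1 - J) = 4 := by
    rw [← mul_add, add_add_sub_cancel]
    norm_num
  generalize 1 + J = E at *
  generalize 1 - J = F at *
  calc (E + Z * F) * (E + F * Z')
      = E * E + E * F * Z' + Z * (F * E) + Z * (F * F) * Z' := by noncomm_ring
    _ = 2 * E + Z * (2 * F) * Z' := by rw [hEE, hEF, hFE, hFF]; noncomm_ring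
    _ = 2 * E + 2 * F := by
      rw [two_mul F, (hF.add_right hF).eq, mul_assoc, hZZ', mul_one]
    _ = 4 := h22

theorem one_add_add_mul_one_sub_intertwining {J Z N N₁ : A} (hZN : Z * N = N₁)
    (hNZ : N₁ * Z = N) (hJN : J * N = -(N * J)) :
    (1 + J + Z * (1 - J)) * N = N₁ * (1 + J + Z * (1 - J)) := by
  calc (1 + J + Z * (1 - J)) * N = N + J * N + Z * N - Z * (J * N) := by noncomm_ring
    _ = N - N * J + Z * N + Z * N * J := by rw [hJN]; noncomm_ring
    _ = N₁ + N₁ * J + N₁ * Z - N₁ * Z * J := by rw [hZN, hNZ]; noncomm_ring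
    _ = _ := by noncomm_ring

end Algebra

section Hilbert

variable {H : Type*} [NormedAddCommGroup H] [InnerProductSpace ℂ H] [CompleteSpace H]

/-- The map `(x, k) ↦ A x + k` on `H × ker A*` has dense range. -/
theorem denseRange_coprod_ker_star (A : H →L[ℂ] H) (K : Submodule ℂ H)
    (hK : K = (star A).ker) :
    DenseRange ((A : H →ₗ[ℂ] H).coprod K.subtype) := by
  rw [DenseRange, ← LinearMap.coe_range, Submodule.dense_iff_topologicalClosure_eq_top,
    Submodule.topologicalClosure_eq_top_iff, LinearMap.range_coprod, Submodule.range_subtype,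
    ← Submodule.inf_orthogonal, ContinuousLinearMap.orthogonal_range, hK]
  exact Submodule.inf_orthogonal_eq_bot _

/-- Operators with the same `A* A` and the same `A A*` differ by a unitary
which fixes the orthogonal complement of the range. -/
theorem exists_unitary_mul_eq {A B : H →L[ℂ] H} (h : star A * A = star B * B)
    (h' : A * star A = B * star B) :
    ∃ Z ∈ unitary (H →L[ℂ] H), Z * A = B ∧ ∀ k, star A k = 0 → Z k = k := by
  have hk : (star B).ker = (star A).ker :=
    (ContinuousLinearMap.ker_self_comp_adjoint B).symm.trans
      ((congrArg (fun T : H →L[ℂ] H ↦ T.ker) h').symm.trans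
        (ContinuousLinearMap.ker_self_comp_adjoint A))
  set K := (star A).ker with hK
  have key : ∀ (C : H →L[ℂ] H) (x : H) (k : K), K = (star C).ker →
      ‖C x + k‖ * ‖C x + k‖ = RCLike.re ⟪(star C * C) x, x⟫_ℂ + ‖k‖ * ‖k‖ := by
    intro C x k hC
    have hk0 : star C (k : H) = 0 := by
      have : (k : H) ∈ (star C).ker := hC ▸ k.2
      exact this
    rw [norm_add_sq_eq_norm_sq_add_norm_sq_of_inner_eq_zero (𝕜 := ℂ), ← sq ‖C x‖,
      ContinuousLinearMap.apply_norm_sq_eq_inner_adjoint_left]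
    · rfl
    · rw [← ContinuousLinearMap.adjoint_inner_right, ← ContinuousLinearMap.star_eq_adjoint, hk0,
        inner_zero_right]
  let Z := (LinearEquiv.refl ℂ (H × K)).extendOfIsometry
    ((A : H →ₗ[ℂ] H).coprod K.subtype) ((B : H →ₗ[ℂ] H).coprod K.subtype)
    (denseRange_coprod_ker_star A K hK) (denseRange_coprod_ker_star B K hk.symm) (by
      rintro ⟨x, k⟩
      have := (key B x k hk.symm).trans ((key A x k hK).trans (by rw [h])).symm
      exact (mul_self_inj (norm_nonneg _) (norm_nonneg _)).1 this)
  have hZ : ∀ (x : H) (k : K), Z (A x + k) = B x + k := by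
    intro x k
    simpa using LinearEquiv.extendOfIsometry_eq (f := LinearEquiv.refl ℂ (H × K)) (e₁ :=
      (A : H →ₗ[ℂ] H).coprod K.subtype) (e₂ := (B : H →ₗ[ℂ] H).coprod K.subtype) _ _ _ (x, k)
  refine ⟨(Unitary.linearIsometryEquiv.symm Z : unitary (H →L[ℂ] H)), Subtype.prop _, ?_, ?_⟩
  · ext x
    simpa using hZ x 0
  · intro k hkk
    simpa using hZ 0 ⟨k, hkk⟩

/-- If `M` is self-adjoint and invertible, it has a self-adjoint unitary sign. -/
theorem exists_sign {M : H →L[ℂ] H} (hM : IsSelfAdjoint M) (hu : IsUnit M) :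
    ∃ J : H →L[ℂ] H, IsSelfAdjoint J ∧ J * J = 1 ∧ (∀ X, Commute X M → Commute X J) ∧
      ∀ X, M * X = -(X * M) → J * X = -(X * J) := by
  have hpos : ∀ x ∈ spectrum ℝ (M * M), 0 < x := by
    intro x hx
    have h0 : 0 ≤ M * M := by simpa [hM.star_eq] using star_mul_self_nonneg M
    refine (spectrum_nonneg_of_nonneg h0 hx).lt_of_ne ?_
    rintro rfl
    exact spectrum.zero_notMem ℝ (hu.mul hu) hx
  have hMM : IsSelfAdjoint (M * M) := by simp [IsSelfAdjoint, hM.star_eq]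
  have hc : ContinuousOn (fun x : ℝ ↦ 1 / √x) (spectrum ℝ (M * M)) :=
    continuousOn_const.div Real.continuous_sqrt.continuousOn
      fun x hx ↦ (Real.sqrt_pos.2 (hpos x hx)).ne'
  set T := cfc (fun x : ℝ ↦ 1 / √x) (M * M) with hT
  have hTs : IsSelfAdjoint T := cfc_predicate _ _
  have hcomm : ∀ X, Commute X (M * M) → Commute X T := fun X hX ↦
    (hX.symm.cfc_real _).symm
  have hTM : Commute T M := (hcomm M (by simp [commute_iff_eq, mul_assoc])).symm
  have hTT : T * T * (M * M) = 1 := by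
    conv_lhs => rw [← cfc_id' ℝ (M * M)]
    rw [hT, ← cfc_mul _ _ (M * M), ← cfc_mul _ _ (M * M), ← cfc_one ℝ (M * M)]
    refine cfc_congr fun x hx ↦ ?_
    have h := hpos x hx
    have h2 := Real.sqrt_pos.2 h
    have h3 := Real.mul_self_sqrt h.le
    simp only [Pi.one_apply]
    field_simp
    rw [sq, h3]
  refine ⟨T * M, ?_, ?_, ?_, ?_⟩
  · rw [IsSelfAdjoint, star_mul, hTs.star_eq, hM.star_eq, hTM.eq]
  · rw [← hTT]
    rw [mul_assoc, ← mul_assoc M T M, ← hTM.eq, mul_assoc T M M, ← mul_assoc]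
  · intro X hX
    exact (hcomm X (hX.mul_right hX)).mul_right hX
  · intro X hX
    have h1 := (hcomm X (commute_sq_of_anticommute hX)).eq
    rw [mul_assoc, hX, mul_neg, ← mul_assoc, ← h1, mul_assoc]

theorem exists_unitary_commute_intertwining {R R₁ M b : H →L[ℂ] H}
    (hRs : IsSelfAdjoint R) (hR₁s : IsSelfAdjoint R₁) (hMs : IsSelfAdjoint M)
    (hR : R * R = 1) (hR₁ : R₁ * R₁ = 1) (hM : IsUnit M)
    (hb : R * M + M * R = b) (hb₁ : R₁ * M + M * R₁ = b)
    (hbM : ∀ X, Commute X M → Commute X b) :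
    ∃ U ∈ unitary (H →L[ℂ] H), Commute U M ∧ U * R = R₁ * U := by
  have hbM' : Commute b M := (hbM M (Commute.refl M)).symm
  have hRM := commute_sq_of_anticommutator_eq hb hbM'
  have hRM₁ := commute_sq_of_anticommutator_eq hb₁ hbM'
  have hNN := (commutator_mul_commutator hR hb hbM').trans
    (commutator_mul_commutator hR₁ hb₁ hbM').symm
  have hMN := commutator_anticommute hRM
  have hMN₁ := commutator_anticommute hRM₁
  have hN : R * M - M * R = 2 * (R * M) - b := by rw [← hb]; noncomm_ring
  have hN₁ : R₁ * M - M * R₁ = 2 * (R₁ * M) - b := by rw [← hb₁]; noncomm_ring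
  have hNs : star (R * M - M * R) = -(R * M - M * R) := by
    simp [hRs.star_eq, hMs.star_eq]
  have hN₁s : star (R₁ * M - M * R₁) = -(R₁ * M - M * R₁) := by
    simp [hR₁s.star_eq, hMs.star_eq]
  set N := R * M - M * R
  set N₁ := R₁ * M - M * R₁
  obtain ⟨Z, hZ, hZN, hZk⟩ := exists_unitary_mul_eq (A := N) (B := N₁)
    (by rw [hNs, hN₁s, neg_mul, neg_mul, hNN]) (by rw [hNs, hN₁s, mul_neg, mul_neg, hNN])
  have hZZ := (Unitary.mem_iff.1 hZ).1
  have hZZ' := (Unitary.mem_iff.1 hZ).2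
  have hN₁Z : N₁ * Z = N := by
    have : star Z * N₁ = N := by rw [← hZN, ← mul_assoc, hZZ, one_mul]
    have := congrArg star this
    rwa [star_mul, star_star, hNs, hN₁s, neg_mul, neg_inj] at this
  have hZM : Commute Z M := by
    rw [commute_iff_eq]
    ext y
    refine (denseRange_coprod_ker_star N (star N).ker rfl).induction_on
      (p := fun y ↦ (Z * M) y = (M * Z) y) y ?_ ?_
    · exact isClosed_eq (by fun_prop) (by fun_prop)
    · rintro ⟨x, k, hk⟩
      have hk' : star N k = 0 := hk
      have hMk : star N (M k) = 0 := by
        have := congrArg (fun T : H →L[ℂ] H ↦ T k) hMN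
        rw [hNs] at hk' ⊢
        simp only [mul_apply_eq_comp, neg_apply, neg_eq_zero] at this hk' ⊢
        rwa [hk', map_zero, eq_comm, neg_eq_zero] at this
      have e1 : Z * M * N = M * Z * N := by
        have : Z * (M * N) = M * N₁ := by rw [hMN, hMN₁, mul_neg, ← mul_assoc, hZN]
        rw [mul_assoc, this, mul_assoc, hZN]
      have e2 := congrArg (fun T : H →L[ℂ] H ↦ T x) e1
      simp at e2 ⊢
      rw [e2, hZk k hk', hZk (M k) hMk]
  obtain ⟨J, hJs, hJJ, hJc, hJa⟩ := exists_sign hMs hM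
  have hJM : J * M = M * J := (hJc M (Commute.refl M)).eq.symm
  have hJZ : Z * J = J * Z := (hJc Z hZM).eq
  have hJN : J * N = -(N * J) := hJa N hMN
  have hJZs : star Z * J = J * star Z := by
    have := congrArg star hJZ
    rw [star_mul, star_mul, hJs.star_eq] at this
    exact this.symm
  have hVV' := one_add_add_mul_one_sub_mul hJJ hZZ' hJZ
  have hVV := one_add_add_mul_one_sub_mul hJJ hZZ hJZs
  have hVN := one_add_add_mul_one_sub_intertwining hZN hN₁Z hJN
  have hVs : star (1 + J + Z * (1 - J)) = 1 + J + (1 - J) * star Z := by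
    simp [hJs.star_eq]
  have hF : Commute (1 - J) M := (Commute.one_left M).sub_left hJM
  have hVM : Commute (1 + J + Z * (1 - J)) M :=
    ((Commute.one_left M).add_left hJM).add_left (hZM.mul_left hF)
  have hZF : Commute (star Z) (1 - J) := (Commute.one_right _).sub_right hJZs
  have hZF' : Commute Z (1 - J) := (Commute.one_right _).sub_right hJZ
  rw [hZF.eq, ← hZF'.eq, ← hVs] at hVV
  rw [← hVs] at hVV'
  generalize 1 + J + Z * (1 - J) = V at *
  have hVb : V * b = b * V := hbM V hVM
  have h2 : V * (2 * (R * M)) = 2 * (R₁ * M) * V := by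
    rw [eq_sub_iff_add_eq] at hN hN₁
    rw [← hN, ← hN₁, mul_add, add_mul, hVN, hVb]
  have hVR : V * R = R₁ * V := by
    refine hM.mul_right_cancel (IsUnit.mul_left_cancel (a := 2) ?_ ?_)
    · rw [← map_ofNat (algebraMap ℂ (H →L[ℂ] H)) 2]
      exact (IsUnit.mk0 (2 : ℂ) two_ne_zero).map (algebraMap ℂ (H →L[ℂ] H))
    · calc 2 * (V * R * M) = V * (2 * (R * M)) := by noncomm_ring
        _ = 2 * (R₁ * (M * V)) := by rw [h2]; noncomm_ring
        _ = 2 * (R₁ * V * M) := by rw [← hVM.eq, mul_assoc R₁]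
  refine ⟨(2⁻¹ : ℂ) • V, ?_, ?_, ?_⟩
  · have h4 : (2⁻¹ * 2⁻¹ : ℂ) • (4 : H →L[ℂ] H) = 1 := by
      rw [← map_ofNat (algebraMap ℂ (H →L[ℂ] H)) 4, Algebra.algebraMap_eq_smul_one, smul_smul]
      norm_num
    rw [Unitary.mem_iff]
    simp only [star_smul, star_inv₀, star_ofNat, smul_mul_smul_comm, hVV, hVV', h4, and_self]
  · exact Commute.smul_left hVM _
  · rw [smul_mul_assoc, mul_smul_comm, hVR]

theorem isUnit_smul_add {R S : H →L[ℂ] H} (hRs : IsSelfAdjoint R) (hSs : IsSelfAdjoint S)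
    (hR : R * R = 1) (hS : S * S = 1) {l : ℝ} (hl : l ≠ -1) (hl' : l ≠ 1) (hl0 : l ≠ 0) :
    IsUnit ((l : ℂ) • R + S) := by
  have hlc : (l : ℂ) ≠ 0 := Complex.ofReal_ne_zero.2 hl0
  have hW : S * R ∈ unitary (H →L[ℂ] H) := by
    rw [Unitary.mem_iff, star_mul, hRs.star_eq, hSs.star_eq]
    constructor
    · rw [mul_assoc, ← mul_assoc S, hS, one_mul, hR]
    · rw [mul_assoc, ← mul_assoc R, hR, one_mul, hS]
  have h1 : IsUnit (algebraMap ℂ (H →L[ℂ] H) (-(l : ℂ)⁻¹) - S * R) := by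
    by_contra hc
    have := Unitary.spectrum_subset_circle ⟨_, hW⟩ (spectrum.mem_iff.2 hc)
    simp only [mem_sphere_iff_norm, sub_zero, norm_neg, norm_inv, Complex.norm_real,
      Real.norm_eq_abs, inv_eq_one] at this
    rcases eq_or_eq_neg_of_abs_eq this with h | h
    exacts [hl' h, hl h]
  have h2 : (l : ℂ) • R + S =
      (-(l : ℂ)) • (S * (algebraMap ℂ (H →L[ℂ] H) (-(l : ℂ)⁻¹) - S * R)) := by
    rw [mul_sub, ← mul_assoc, hS, one_mul, Algebra.algebraMap_eq_smul_one, mul_smul_comm, mul_one,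
      smul_sub, smul_smul, neg_mul_neg, mul_inv_cancel₀ hlc, one_smul, neg_smul, sub_neg_eq_add,
      add_comm]
  rw [h2]
  exact ((Units.mk S S hS hS).isUnit.mul h1).smul (Units.mk0 _ (neg_ne_zero.2 hlc))

/-- Pairs of self-adjoint involutions with the same pencil are unitarily equivalent. -/
theorem exists_unitary_of_smul_add_eq {R S R₁ S₁ : H →L[ℂ] H}
    (hRs : IsSelfAdjoint R) (hSs : IsSelfAdjoint S) (hR₁s : IsSelfAdjoint R₁)
    (hR : R * R = 1) (hS : S * S = 1) (hR₁ : R₁ * R₁ = 1) (hS₁ : S₁ * S₁ = 1)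
    {l : ℝ} (hl : l ≠ -1) (hl' : l ≠ 1) (hl0 : l ≠ 0)
    (h : (l : ℂ) • R + S = (l : ℂ) • R₁ + S₁) :
    ∃ U ∈ unitary (H →L[ℂ] H), U * R = R₁ * U ∧ U * S = S₁ * U := by
  have hlc : (l : ℂ) ≠ 0 := Complex.ofReal_ne_zero.2 hl0
  have hM := isUnit_smul_add hRs hSs hR hS hl hl' hl0
  have hanti : ∀ {R S M : H →L[ℂ] H}, R * R = 1 → S * S = 1 → (l : ℂ) • R + S = M →
      R * M + M * R = (l : ℂ)⁻¹ • (M * M + ((l : ℂ) ^ 2 - 1) • 1) := by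
    intro R S M hR hS hM
    rw [eq_inv_smul_iff₀ hlc, ← hM]
    simp only [mul_add, add_mul, smul_mul_assoc, mul_smul_comm, hR, hS, smul_add, sub_smul,
      one_smul, smul_smul, sq]
    abel
  obtain ⟨U, hU, hUM, hUR⟩ := exists_unitary_commute_intertwining hRs hR₁s
    (((show IsSelfAdjoint (l : ℂ) from Complex.conj_ofReal l).smul hRs).add hSs) hR hR₁ hM
    (hanti hR hS rfl) (hanti hR₁ hS₁ h.symm) fun X hX ↦
      ((hX.mul_right hX).add_right ((Commute.one_right X).smul_right _)).smul_right _
  refine ⟨U, hU, hUR, ?_⟩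
  have := hUM.eq
  nth_rw 2 [h] at this
  rwa [mul_add, add_mul, mul_smul_comm, smul_mul_assoc, hUR, add_right_inj] at this

theorem mul_mul_star_eq_iff {U A B : H →L[ℂ] H} (hU : U ∈ unitary (H →L[ℂ] H)) :
    U * A * star U = B ↔ U * A = B * U := by
  obtain ⟨h1, h2⟩ := Unitary.mem_iff.1 hU
  constructor
  · rintro rfl
    rw [mul_assoc, h1, mul_one]
  · intro h
    rw [h, mul_assoc, h2, mul_one]

theorem IsOrthoProj.conj {P V : H →L[ℂ] H} (hP : IsOrthoProj P)
    (hV : V ∈ unitary (H →L[ℂ] H)) : IsOrthoProj (V * P * star V) := by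
  refine ⟨hP.1.conjugate V, ?_⟩
  calc V * P * star V * (V * P * star V) = V * P * (star V * V) * P * star V := by noncomm_ring
    _ = V * (P * P) * star V := by rw [(Unitary.mem_iff.1 hV).1]; noncomm_ring
    _ = V * P * star V := by rw [hP.2]

/-- The symmetry `2 P - 1` attached to an orthogonal projection. -/
theorem IsOrthoProj.symmetry {P : H →L[ℂ] H} (hP : IsOrthoProj P) :
    IsSelfAdjoint ((2 : ℂ) • P - 1) ∧ ((2 : ℂ) • P - 1) * ((2 : ℂ) • P - 1) = 1 := by
  constructor
  · simp [IsSelfAdjoint, hP.1.star_eq]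
  · simp only [two_smul, mul_sub, sub_mul, mul_add, add_mul, hP.2, mul_one, one_mul]
    abel

theorem exists_unitary_of_isOrthoProj_smul_add_eq {P Q P₁ Q₁ : H →L[ℂ] H}
    (hP : IsOrthoProj P) (hQ : IsOrthoProj Q) (hP₁ : IsOrthoProj P₁) (hQ₁ : IsOrthoProj Q₁)
    {l : ℝ} (hl : l ≠ -1) (hl' : l ≠ 1) (hl0 : l ≠ 0)
    (h : (l : ℂ) • P + Q = (l : ℂ) • P₁ + Q₁) :
    ∃ U ∈ unitary (H →L[ℂ] H), U * P = P₁ * U ∧ U * Q = Q₁ * U := by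
  have hpencil : (l : ℂ) • ((2 : ℂ) • P - 1) + ((2 : ℂ) • Q - 1) =
      (l : ℂ) • ((2 : ℂ) • P₁ - 1) + ((2 : ℂ) • Q₁ - 1) := by
    have := congrArg (fun T ↦ (2 : ℂ) • T - (l : ℂ) • (1 : H →L[ℂ] H) - 1) h
    simp only [smul_add, smul_comm (2 : ℂ) (l : ℂ)] at this
    rw [smul_sub, smul_sub]
    convert this using 1 <;> abel
  obtain ⟨U, hU, hUP, hUQ⟩ := exists_unitary_of_smul_add_eq hP.symmetry.1 hQ.symmetry.1
    hP₁.symmetry.1 hP.symmetry.2 hQ.symmetry.2 hP₁.symmetry.2 hQ₁.symmetry.2 hl hl' hl0 hpencil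
  have hcancel : ∀ {A B : H →L[ℂ] H}, U * ((2 : ℂ) • A - 1) = ((2 : ℂ) • B - 1) * U →
      U * A = B * U := by
    intro A B hAB
    rw [mul_sub, sub_mul, mul_one, one_mul, sub_left_inj, mul_smul_comm, smul_mul_assoc] at hAB
    exact smul_right_injective _ (two_ne_zero (α := ℂ)) hAB
  exact ⟨U, hU, hcancel hUP, hcancel hUQ⟩

end Hilbert

/-- For `λ ∈ ℝ \ {−1, 0, 1}`, two pairs of projections `(P, Q)` and `(P₁, Q₁)` are
simultaneously unitarily equivalent if and only if the pencils `λP + Q` and `λP₁ + Q₁`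
are unitarily equivalent. -/
theorem pairs_unitarily_equivalent_iff_pencils {H : Type*} [NormedAddCommGroup H]
    [InnerProductSpace ℂ H] [CompleteSpace H]
    (lam : ℝ) (hlam : lam ≠ -1 ∧ lam ≠ 0 ∧ lam ≠ 1)
    (P Q P₁ Q₁ : H →L[ℂ] H)
    (hP : IsOrthoProj P) (hQ : IsOrthoProj Q)
    (hP₁ : IsOrthoProj P₁) (hQ₁ : IsOrthoProj Q₁) :
    (∃ U ∈ unitary (H →L[ℂ] H), U * P * star U = P₁ ∧ U * Q * star U = Q₁) ↔
    (∃ V ∈ unitary (H →L[ℂ] H),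
      V * ((lam : ℂ) • P + Q) * star V = (lam : ℂ) • P₁ + Q₁) := by
  constructor
  · rintro ⟨U, hU, rfl, rfl⟩
    exact ⟨U, hU, by simp only [mul_add, add_mul, mul_smul_comm, smul_mul_assoc]⟩
  · rintro ⟨V, hV, h⟩
    simp only [mul_add, add_mul, mul_smul_comm, smul_mul_assoc] at h
    obtain ⟨U, hU, hUP, hUQ⟩ := exists_unitary_of_isOrthoProj_smul_add_eq (hP.conj hV)
      (hQ.conj hV) hP₁ hQ₁ hlam.1 hlam.2.2 hlam.2.1 h
    refine ⟨U * V, mul_mem hU hV, ?_, ?_⟩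
    · rw [← (mul_mul_star_eq_iff hU).2 hUP, star_mul]
      simp only [mul_assoc]
    · rw [← (mul_mul_star_eq_iff hU).2 hUQ, star_mul]
      simp only [mul_assoc]
end
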